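/- There are infinitely many prime ideals of F in each narrow ray class modulo 𝔣: for any integral ideal 𝔣 of the totally real number field F and any class C of the narrow ray class group modulo 𝔣, there exist infinitely many prime ideals 𝔯 of F with [𝔯] = C. -/

import Mathlib

open NumberField

/-- `x ∈ F` is totally positive. -/
def IsTotallyPositiveElem (F : Type*) [Field F] [NumberField F] (x : F) : Prop :=
  ∀ φ : F →+* ℝ, 0 < φ x

/-- Two (integral) ideals `a`, `b` of `F` lie in the same narrow ray class modulo `𝔣`:
there are totally positive `α, β ≡ 1 (mod 𝔣)` with `(α)·a = (β)·b`. -/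
def SameNarrowRayClass (F : Type*) [Field F] [NumberField F]
    (𝔣 a b : Ideal (𝓞 F)) : Prop :=
  ∃ α β : 𝓞 F, α ≠ 0 ∧ β ≠ 0 ∧
    IsTotallyPositiveElem F (algebraMap (𝓞 F) F α) ∧
    IsTotallyPositiveElem F (algebraMap (𝓞 F) F β) ∧
    α - 1 ∈ 𝔣 ∧ β - 1 ∈ 𝔣 ∧
    Ideal.span {α} * a = Ideal.span {β} * b

set_option linter.unusedSectionVars false

namespace LatticeSum

open MeasureTheory Submodule Module Metric
open scoped ContDiff Pointwise

variable {V : Type*} [NormedAddCommGroup V] [NormedSpace ℝ V] [FiniteDimensional ℝ V]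
  {ι : Type*} [Fintype ι]

/-- The Riemann sum of `Ψ` over the translate by `c` of the lattice spanned by `b`,
scaled by `h`. -/
noncomputable def latticeSum (b : Basis ι ℝ V) (Ψ : V → ℝ) (h : ℝ) (c : V) : ℝ :=
  h ^ finrank ℝ V * ∑' l : span ℤ (Set.range b), Ψ (h • (c + l))

theorem exists_finset_of_bounded (b : Basis ι ℝ V) {Ψ : V → ℝ} (hc : HasCompactSupport Ψ)
    {h : ℝ} (hh : 0 < h) {B : Set V} (hB : Bornology.IsBounded B) :
    ∃ T : Finset (span ℤ (Set.range b)), ∀ l ∉ T, ∀ c ∈ B, Ψ (h • (c + l)) = 0 := by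
  obtain ⟨R, hR⟩ := (isBounded_iff_forall_norm_le.1 hc.isCompact.isBounded)
  obtain ⟨R', hR'⟩ := (isBounded_iff_forall_norm_le.1 hB)
  have hfin := ZSpan.setFinite_inter b (isBounded_closedBall (x := (0 : V)) (r := R / h + R'))
  have hfin' : {l : span ℤ (Set.range b) | ‖(l : V)‖ ≤ R / h + R'}.Finite := by
    refine Set.Finite.of_finite_image (f := Subtype.val) (hfin.subset ?_)
      Subtype.val_injective.injOn
    rintro _ ⟨l, hl, rfl⟩
    exact ⟨by simpa using hl, l.2⟩
  refine ⟨hfin'.toFinset, fun l hl c hcB => ?_⟩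
  by_contra hne
  apply hl
  simp only [Set.Finite.mem_toFinset, Set.mem_ofPred_eq]
  have h1 := hR _ (subset_tsupport _ hne)
  rw [norm_smul, Real.norm_of_nonneg hh.le] at h1
  have h2 : ‖c + l‖ ≤ R / h := by rw [le_div_iff₀ hh]; linarith
  have h3 := hR' c hcB
  calc ‖(l : V)‖ = ‖(c + l) - c‖ := by simp
    _ ≤ _ := (norm_sub_le _ _).trans (add_le_add h2 h3)

theorem latticeSum_eq_sum (b : Basis ι ℝ V) {Ψ : V → ℝ} {h : ℝ} {c : V}
    {T : Finset (span ℤ (Set.range b))} (hT : ∀ l ∉ T, Ψ (h • (c + l)) = 0) :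
    latticeSum b Ψ h c = h ^ finrank ℝ V * ∑ l ∈ T, Ψ (h • (c + l)) := by
  rw [latticeSum, tsum_eq_sum hT]

variable [MeasurableSpace V] [BorelSpace V] (μ : Measure V) [μ.IsAddHaarMeasure]

theorem vaddInvariantMeasure_span (b : Basis ι ℝ V) :
    VAddInvariantMeasure (span ℤ (Set.range b)) V μ :=
  inferInstanceAs (VAddInvariantMeasure (span ℤ (Set.range b)).toAddSubgroup V μ)

theorem latticeSum_bounded (μ : Measure V) [μ.IsAddHaarMeasure] (b : Basis ι ℝ V) {Ψ : V → ℝ}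
    (hΨ : Continuous Ψ) (hc : HasCompactSupport Ψ) :
    ∃ C, ∀ h ∈ Set.Ioc (0 : ℝ) 1, ∀ c, |latticeSum b Ψ h c| ≤ C := by
  obtain ⟨M, hM⟩ := hΨ.bounded_above_of_compact_support hc
  obtain ⟨R, hR⟩ := (isBounded_iff_forall_norm_le.1 hc.isCompact.isBounded)
  obtain ⟨R₁, hR₁⟩ := (isBounded_iff_forall_norm_le.1 (ZSpan.fundamentalDomain_isBounded b))
  set D := ZSpan.fundamentalDomain b
  set R' := max R 0 + max R₁ 0
  have hR'0 : 0 ≤ R' := by positivity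
  have hD0 : μ D ≠ 0 := ZSpan.measure_fundamentalDomain_ne_zero b
  have hDt : μ D ≠ ⊤ := (ZSpan.fundamentalDomain_isBounded b).measure_lt_top.ne
  refine ⟨M * (μ (closedBall 0 R')).toReal / (μ D).toReal, fun h hh c => ?_⟩
  obtain ⟨T, hT⟩ := exists_finset_of_bounded b hc hh.1 (Bornology.isBounded_singleton (x := c))
  classical
  set T' := T.filter fun l : span ℤ (Set.range b) => Ψ (h • (c + (l : V))) ≠ 0
  have hT' : ∀ l ∉ T', Ψ (h • (c + l)) = 0 := by
    intro l hl
    by_contra hne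
    refine hl (Finset.mem_filter.2 ⟨?_, hne⟩)
    by_contra h'
    exact hne (hT l h' c rfl)
  have key : (T'.card : ENNReal) * μ D ≤ ENNReal.ofReal ((h⁻¹) ^ finrank ℝ V) * μ (closedBall 0 R') := by
    have h1 : μ (closedBall (-c) (h⁻¹ * R')) =
        ENNReal.ofReal ((h⁻¹) ^ finrank ℝ V) * μ (closedBall 0 R') :=
      Measure.addHaar_closedBall_mul_of_pos μ _ (inv_pos.2 hh.1) _
    have := vaddInvariantMeasure_span μ b
    have h2 := (ZSpan.isAddFundamentalDomain b μ).lintegral_eq_tsum''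
      ((closedBall (-c) (h⁻¹ * R')).indicator 1)
    rw [lintegral_indicator_one measurableSet_closedBall, h1] at h2
    rw [h2]
    refine le_trans ?_ (ENNReal.sum_le_tsum T')
    rw [← nsmul_eq_mul, ← Finset.sum_const]
    refine Finset.sum_le_sum fun l hl => ?_
    rw [← setLIntegral_one]
    refine setLIntegral_mono' (ZSpan.fundamentalDomain_measurableSet b) fun v hv => ?_
    rw [Set.indicator_of_mem]
    · simp
    · rw [mem_closedBall, dist_eq_norm, sub_neg_eq_add]
      have h3 := hR _ (subset_tsupport _ (Finset.mem_filter.1 hl).2)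
      rw [norm_smul, Real.norm_of_nonneg hh.1.le] at h3
      have h4 : ‖c + l‖ ≤ h⁻¹ * R := by
        rw [inv_mul_eq_div, le_div_iff₀ hh.1]; linarith
      have h5 : ‖v‖ ≤ R₁ := hR₁ v hv
      have h6 : (1 : ℝ) ≤ h⁻¹ := (one_le_inv₀ hh.1).2 hh.2
      calc ‖(l +ᵥ v) + c‖ = ‖(c + l) + v‖ := by
            congr 1; rw [Submodule.vadd_def, vadd_eq_add]; abel
        _ ≤ h⁻¹ * R + R₁ := (norm_add_le _ _).trans (add_le_add h4 h5)
        _ ≤ h⁻¹ * max R 0 + h⁻¹ * max R₁ 0 := by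
            gcongr
            · exact le_max_left _ _
            · exact (le_max_left _ _).trans (le_mul_of_one_le_left (le_max_right _ _) h6)
        _ = _ := by rw [← mul_add]
  have key' : (T'.card : ℝ) * (μ D).toReal ≤ (h⁻¹) ^ finrank ℝ V * (μ (closedBall 0 R')).toReal := by
    have := ENNReal.toReal_mono
      (ENNReal.mul_ne_top ENNReal.ofReal_ne_top measure_closedBall_lt_top.ne) key
    rwa [ENNReal.toReal_mul, ENNReal.toReal_mul, ENNReal.toReal_natCast,
      ENNReal.toReal_ofReal (by have := hh.1; positivity)] at this
  have hDpos : 0 < (μ D).toReal := ENNReal.toReal_pos hD0 hDt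
  have hM0 : 0 ≤ M := (norm_nonneg _).trans (hM 0)
  have hhn : 0 < h ^ finrank ℝ V := pow_pos hh.1 _
  rw [latticeSum_eq_sum b hT', abs_mul, abs_of_pos hhn, le_div_iff₀ hDpos]
  have h7 : |∑ l ∈ T', Ψ (h • (c + l))| ≤ T'.card * M := by
    refine (Finset.abs_sum_le_sum_abs _ _).trans ?_
    rw [← nsmul_eq_mul]
    exact Finset.sum_le_card_nsmul _ _ _ fun l _ => hM _
  calc _ ≤ h ^ finrank ℝ V * (T'.card * M) * (μ D).toReal := by gcongr
    _ = h ^ finrank ℝ V * M * (T'.card * (μ D).toReal) := by ring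
    _ ≤ h ^ finrank ℝ V * M * ((h⁻¹) ^ finrank ℝ V * (μ (closedBall 0 R')).toReal) := by gcongr
    _ = _ := by rw [inv_pow]; field_simp

theorem setIntegral_latticeSum (b : Basis ι ℝ V) {Ψ : V → ℝ} (hΨ : Continuous Ψ)
    (hc : HasCompactSupport Ψ) {h : ℝ} (hh : 0 < h) (c : V) :
    ∫ v in ZSpan.fundamentalDomain b, latticeSum b Ψ h (c + v) ∂μ = ∫ x, Ψ x ∂μ := by
  set D := ZSpan.fundamentalDomain b
  have hDb : Bornology.IsBounded D := ZSpan.fundamentalDomain_isBounded b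
  obtain ⟨R₁, hR₁⟩ := (isBounded_iff_forall_norm_le.1 hDb)
  obtain ⟨T, hT⟩ := exists_finset_of_bounded b hc hh
    (isBounded_closedBall (x := (0 : V)) (r := ‖c‖ + R₁))
  have hT' : ∀ l ∉ T, ∀ v ∈ D, Ψ (h • (c + v + l)) = 0 := fun l hl v hv => by
    refine hT l hl _ ?_
    rw [mem_closedBall_zero_iff]
    exact (norm_add_le _ _).trans (add_le_add le_rfl (hR₁ v hv))
  have hcs : HasCompactSupport fun x => Ψ (h • (c + x)) :=
    hc.comp_homeomorph ((Homeomorph.addLeft c).trans (Homeomorph.smulOfNeZero h hh.ne'))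
  have hint : Integrable (fun x => Ψ (h • (c + x))) μ :=
    (by fun_prop : Continuous fun x => Ψ (h • (c + x))).integrable_of_hasCompactSupport hcs
  have := vaddInvariantMeasure_span μ b
  have h1 := (ZSpan.isAddFundamentalDomain b μ).integral_eq_tsum'' _ hint
  have h2 : ∫ x, Ψ (h • (c + x)) ∂μ = (h ^ finrank ℝ V)⁻¹ * ∫ x, Ψ x ∂μ := by
    rw [integral_add_left_eq_self (fun x => Ψ (h • x)) c,
      Measure.integral_comp_smul_of_nonneg μ Ψ h (hR := hh.le), smul_eq_mul]
  have h3 : ∫ v in D, latticeSum b Ψ h (c + v) ∂μ =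
      ∫ v in D, h ^ finrank ℝ V * ∑ l ∈ T, Ψ (h • (c + v + l)) ∂μ :=
    setIntegral_congr_fun (ZSpan.fundamentalDomain_measurableSet b) fun v hv =>
      latticeSum_eq_sum b fun l hl => hT' l hl v hv
  have h4 : ∀ l : span ℤ (Set.range b), (fun v => Ψ (h • (c + (l +ᵥ v)))) =
      fun v => Ψ (h • (c + v + l)) := by
    intro l; ext v; rw [Submodule.vadd_def, vadd_eq_add, add_comm (l : V) v, add_assoc]
  rw [h3, integral_const_mul, integral_finsetSum]
  · have h5 : ∑ l ∈ T, ∫ v in D, Ψ (h • (c + v + l)) ∂μ = ∫ x, Ψ (h • (c + x)) ∂μ := by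
      rw [h1, tsum_eq_sum (s := T)]
      · exact Finset.sum_congr rfl fun l _ => by rw [h4 l]
      · intro l hl
        rw [h4 l]
        exact setIntegral_eq_zero_of_forall_eq_zero fun v hv => hT' l hl v hv
    rw [h5, h2, mul_inv_cancel_left₀ (pow_pos hh _).ne']
  · intro l _
    exact ((by fun_prop : Continuous fun v => Ψ (h • (c + v + (l : V)))).continuousOn.integrableOn_compact
      hDb.isCompact_closure).mono_set subset_closure

theorem integrableOn_latticeSum (b : Basis ι ℝ V) {Ψ : V → ℝ} (hΨ : Continuous Ψ)
    (hc : HasCompactSupport Ψ) {h : ℝ} (hh : 0 < h) (c : V) :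
    IntegrableOn (fun v => latticeSum b Ψ h (c + v)) (ZSpan.fundamentalDomain b) μ := by
  have hDb : Bornology.IsBounded (ZSpan.fundamentalDomain b) := ZSpan.fundamentalDomain_isBounded b
  obtain ⟨R₁, hR₁⟩ := (isBounded_iff_forall_norm_le.1 hDb)
  obtain ⟨T, hT⟩ := exists_finset_of_bounded b hc hh
    (isBounded_closedBall (x := (0 : V)) (r := ‖c‖ + R₁))
  have h1 : Set.EqOn (fun v => h ^ finrank ℝ V * ∑ l ∈ T, Ψ (h • (c + v + (l : V))))
      (fun v => latticeSum b Ψ h (c + v)) (ZSpan.fundamentalDomain b) := fun v hv =>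
    (latticeSum_eq_sum b fun l hl => hT l hl _ <| by
      rw [mem_closedBall_zero_iff]
      exact (norm_add_le _ _).trans (add_le_add le_rfl (hR₁ v hv))).symm
  refine IntegrableOn.congr_fun ?_ h1 (ZSpan.fundamentalDomain_measurableSet b)
  exact ((by fun_prop : Continuous fun v => h ^ finrank ℝ V *
    ∑ l ∈ T, Ψ (h • (c + v + (l : V)))).continuousOn.integrableOn_compact
      hDb.isCompact_closure).mono_set subset_closure

theorem hasDerivAt_latticeSum (b : Basis ι ℝ V) {Ψ : V → ℝ} (hΨ : ContDiff ℝ ∞ Ψ)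
    (hc : HasCompactSupport Ψ) {h : ℝ} (hh : 0 < h) (c v : V) (t : ℝ) :
    HasDerivAt (fun t : ℝ => latticeSum b Ψ h (c + t • v))
      (h * ∑ i, b.repr v i * latticeSum b (fun x => fderiv ℝ Ψ x (b i)) h (c + t • v)) t := by
  have hc' : ∀ i, HasCompactSupport fun x => fderiv ℝ Ψ x (b i) := fun i => hc.fderiv_apply ℝ _
  have hB : Bornology.IsBounded ((fun s : ℝ => c + s • v) '' Set.Icc (t - 1) (t + 1)) :=
    (isCompact_Icc.image (by fun_prop)).isBounded
  obtain ⟨T, hT⟩ := exists_finset_of_bounded b hc hh hB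
  choose T' hT' using fun i => exists_finset_of_bounded b (hc' i) hh hB
  classical
  set A := T ∪ Finset.univ.biUnion T'
  have ht : t ∈ Set.Icc (t - 1) (t + 1) := ⟨by linarith, by linarith⟩
  have h1 : (fun s : ℝ => latticeSum b Ψ h (c + s • v)) =ᶠ[nhds t]
      fun s => h ^ finrank ℝ V * ∑ l ∈ A, Ψ (h • (c + s • v + (l : V))) := by
    filter_upwards [Icc_mem_nhds (show t - 1 < t by linarith) (show t < t + 1 by linarith)]
      with s hs
    exact latticeSum_eq_sum b fun l hl => hT l (fun h => hl (Finset.mem_union_left _ h)) _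
      ⟨s, hs, rfl⟩
  refine HasDerivAt.congr_of_eventuallyEq ?_ h1
  have h2 : ∀ i, latticeSum b (fun x => fderiv ℝ Ψ x (b i)) h (c + t • v) =
      h ^ finrank ℝ V * ∑ l ∈ A, fderiv ℝ Ψ (h • (c + t • v + (l : V))) (b i) := fun i =>
    latticeSum_eq_sum b fun l hl => hT' i l (fun h => hl (Finset.mem_union_right _
      (Finset.mem_biUnion.2 ⟨i, Finset.mem_univ _, h⟩))) _ ⟨t, ht, rfl⟩
  have h3 : ∀ l : span ℤ (Set.range b), HasDerivAt (fun s : ℝ => Ψ (h • (c + s • v + (l : V))))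
      (fderiv ℝ Ψ (h • (c + t • v + (l : V))) (h • v)) t := fun l => by
    have h4 : HasDerivAt (fun s : ℝ => h • (c + s • v + (l : V))) (h • v) t := by
      have h5 := (((hasDerivAt_id t).smul_const v).const_add c |>.add_const (l : V)).const_smul h
      rw [one_smul] at h5
      exact h5
    exact ((hΨ.differentiable (by simp)).differentiableAt.hasFDerivAt).comp_hasDerivAt t h4
  have h5 := (HasDerivAt.fun_sum fun l (_ : l ∈ A) => h3 l).const_mul (h ^ finrank ℝ V)
  refine h5.congr_deriv ?_
  simp_rw [h2]
  have h6 : ∀ l : span ℤ (Set.range b), fderiv ℝ Ψ (h • (c + t • v + (l : V))) (h • v) =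
      h * ∑ i, b.repr v i * fderiv ℝ Ψ (h • (c + t • v + (l : V))) (b i) := fun l => by
    have h7 := congrArg (fderiv ℝ Ψ (h • (c + t • v + (l : V)))) (b.sum_repr v)
    rw [map_sum] at h7
    rw [map_smul, ← h7, smul_eq_mul]
    simp only [map_smul, smul_eq_mul]
  simp_rw [h6, Finset.mul_sum]
  rw [Finset.sum_comm]
  refine Finset.sum_congr rfl fun i _ => Finset.sum_congr rfl fun l _ => by ring

theorem integral_fderiv_eq_zero (μ : Measure V) [μ.IsAddHaarMeasure] {Ψ : V → ℝ}
    (hΨ : ContDiff ℝ ∞ Ψ) (hc : HasCompactSupport Ψ) (v : V) : ∫ x, fderiv ℝ Ψ x v ∂μ = 0 := by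
  have hcont : Continuous fun x => fderiv ℝ Ψ x v :=
    (hΨ.continuous_fderiv (by simp)).clm_apply continuous_const
  have := integral_mul_fderiv_eq_neg_fderiv_mul_of_integrable (μ := μ) (v := v)
    (f := fun _ => (1 : ℝ)) (g := Ψ) (by simp)
    (by simpa using hcont.integrable_of_hasCompactSupport (hc.fderiv_apply ℝ v))
    (by simpa using hΨ.continuous.integrable_of_hasCompactSupport hc)
    (fun _ _ => by fun_prop)
    (fun x _ => hΨ.differentiable (by simp) x)
  simpa using this

theorem latticeSum_sub_integral_le (b : Basis ι ℝ V) (k : ℕ) {Ψ : V → ℝ} (hΨ : ContDiff ℝ ∞ Ψ)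
    (hc : HasCompactSupport Ψ) :
    ∃ C, ∀ h ∈ Set.Ioc (0 : ℝ) 1, ∀ c,
      |latticeSum b Ψ h c - (∫ x, Ψ x ∂μ) / μ.real (ZSpan.fundamentalDomain b)| ≤ C * h ^ k := by
  induction k generalizing Ψ with
  | zero =>
    obtain ⟨C, hC⟩ := latticeSum_bounded μ b hΨ.continuous hc
    refine ⟨C + |(∫ x, Ψ x ∂μ) / μ.real (ZSpan.fundamentalDomain b)|, fun h hh c => ?_⟩
    rw [pow_zero, mul_one]
    exact (abs_sub _ _).trans (add_le_add (hC h hh c) le_rfl)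
  | succ k ih =>
    have hs : ∀ i, ContDiff ℝ ∞ fun x => fderiv ℝ Ψ x (b i) := fun i =>
      (hΨ.fderiv_right (by simp)).clm_apply contDiff_const
    choose C hC using fun i => ih (hs i) (hc.fderiv_apply ℝ (b i))
    set D := ZSpan.fundamentalDomain b
    have hDpos : 0 < μ.real D := ENNReal.toReal_pos (ZSpan.measure_fundamentalDomain_ne_zero b)
      (ZSpan.fundamentalDomain_isBounded b).measure_lt_top.ne
    have hstep : ∀ h ∈ Set.Ioc (0 : ℝ) 1, ∀ c, ∀ v ∈ D,
        ‖latticeSum b Ψ h (c + v) - latticeSum b Ψ h c‖ ≤ (∑ i, C i) * h ^ (k + 1) := by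
      intro h hh c v hv
      have h1 := norm_image_sub_le_of_norm_deriv_le_segment_01'
        (f := fun t : ℝ => latticeSum b Ψ h (c + t • v)) (C := (∑ i, C i) * h ^ (k + 1))
        (fun t _ => (hasDerivAt_latticeSum b hΨ hc hh.1 c v t).hasDerivWithinAt) ?_
      · simpa using h1
      · intro t _
        have hCi : ∀ i, |latticeSum b (fun x => fderiv ℝ Ψ x (b i)) h (c + t • v)| ≤
            C i * h ^ k := fun i => by
          have := hC i h hh (c + t • v)
          rwa [integral_fderiv_eq_zero μ hΨ hc, zero_div, sub_zero] at this
        rw [norm_mul, Real.norm_of_nonneg hh.1.le, pow_succ', mul_left_comm]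
        refine mul_le_mul_of_nonneg_left ?_ hh.1.le
        rw [Finset.sum_mul]
        refine (norm_sum_le _ _).trans (Finset.sum_le_sum fun i _ => ?_)
        rw [norm_mul]
        have h3 : ‖b.repr v i‖ ≤ 1 := by
          have := (ZSpan.mem_fundamentalDomain b).1 hv i
          rw [Real.norm_of_nonneg this.1]; exact this.2.le
        exact (mul_le_of_le_one_left (norm_nonneg _) h3).trans (hCi i)
    refine ⟨∑ i, C i, fun h hh c => ?_⟩
    have h1 := norm_setIntegral_le_of_norm_le_const (μ := μ)
      (ZSpan.fundamentalDomain_isBounded b).measure_lt_top (hstep h hh c)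
    rw [integral_sub (integrableOn_latticeSum μ b hΨ.continuous hc hh.1 c) 
      (integrableOn_const (ZSpan.fundamentalDomain_isBounded b).measure_lt_top.ne),
      setIntegral_latticeSum μ b hΨ.continuous hc hh.1, setIntegral_const, smul_eq_mul] at h1
    rw [abs_sub_comm]
    have h2 : (∫ x, Ψ x ∂μ) / μ.real D - latticeSum b Ψ h c =
      ((∫ x, Ψ x ∂μ) - μ.real D * latticeSum b Ψ h c) / μ.real D := by field_simp
    rw [h2, abs_div, abs_of_pos hDpos, div_le_iff₀ hDpos]
    exact h1

end LatticeSum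

namespace NarrowRay

variable {F : Type*} [Field F] [NumberField F]

theorem isTotallyPositiveElem_mul {x y : F} (hx : IsTotallyPositiveElem F x)
    (hy : IsTotallyPositiveElem F y) : IsTotallyPositiveElem F (x * y) := fun φ => by
  rw [map_mul]; exact mul_pos (hx φ) (hy φ)

theorem isTotallyPositiveElem_one : IsTotallyPositiveElem F 1 := fun φ => by simp

theorem mul_sub_one_mem {R : Type*} [CommRing R] {I : Ideal R} {x y : R} (hx : x - 1 ∈ I)
    (hy : y - 1 ∈ I) : x * y - 1 ∈ I := by
  have : x * y - 1 = (x - 1) * y + (y - 1) := by ring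
  rw [this]
  exact I.add_mem (I.mul_mem_right _ hx) hy

variable {𝔣 : Ideal (𝓞 F)}

theorem sameNarrowRayClass_refl (a : Ideal (𝓞 F)) : SameNarrowRayClass F 𝔣 a a :=
  ⟨1, 1, one_ne_zero, one_ne_zero, by simpa using isTotallyPositiveElem_one,
    by simpa using isTotallyPositiveElem_one, by simp, by simp, rfl⟩

theorem sameNarrowRayClass_symm {a b : Ideal (𝓞 F)} (h : SameNarrowRayClass F 𝔣 a b) :
    SameNarrowRayClass F 𝔣 b a := by
  obtain ⟨α, β, h1, h2, h3, h4, h5, h6, h7⟩ := h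
  exact ⟨β, α, h2, h1, h4, h3, h6, h5, h7.symm⟩

theorem sameNarrowRayClass_trans {a b c : Ideal (𝓞 F)} (h : SameNarrowRayClass F 𝔣 a b)
    (h' : SameNarrowRayClass F 𝔣 b c) : SameNarrowRayClass F 𝔣 a c := by
  obtain ⟨α, β, h1, h2, h3, h4, h5, h6, h7⟩ := h
  obtain ⟨α', β', h1', h2', h3', h4', h5', h6', h7'⟩ := h'
  refine ⟨α * α', β * β', mul_ne_zero h1 h1', mul_ne_zero h2 h2', ?_, ?_,
    mul_sub_one_mem h5 h5', mul_sub_one_mem h6 h6', ?_⟩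
  · rw [map_mul]; exact isTotallyPositiveElem_mul h3 h3'
  · rw [map_mul]; exact isTotallyPositiveElem_mul h4 h4'
  · rw [← Ideal.span_singleton_mul_span_singleton, ← Ideal.span_singleton_mul_span_singleton,
      mul_right_comm, h7, mul_right_comm, mul_assoc, mul_assoc, ← h7']

theorem sameNarrowRayClass_mul {a b c d : Ideal (𝓞 F)} (h : SameNarrowRayClass F 𝔣 a b)
    (h' : SameNarrowRayClass F 𝔣 c d) : SameNarrowRayClass F 𝔣 (a * c) (b * d) := by
  obtain ⟨α, β, h1, h2, h3, h4, h5, h6, h7⟩ := h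
  obtain ⟨α', β', h1', h2', h3', h4', h5', h6', h7'⟩ := h'
  refine ⟨α * α', β * β', mul_ne_zero h1 h1', mul_ne_zero h2 h2', ?_, ?_,
    mul_sub_one_mem h5 h5', mul_sub_one_mem h6 h6', ?_⟩
  · rw [map_mul]; exact isTotallyPositiveElem_mul h3 h3'
  · rw [map_mul]; exact isTotallyPositiveElem_mul h4 h4'
  · rw [← Ideal.span_singleton_mul_span_singleton, ← Ideal.span_singleton_mul_span_singleton,
      mul_mul_mul_comm, h7, h7', mul_mul_mul_comm]

variable (𝔣) in
/-- The nonzero integral ideals coprime to `𝔣`. -/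
def coprimeIdeals : Submonoid (Ideal (𝓞 F)) where
  carrier := {I | I ≠ ⊥ ∧ IsCoprime I 𝔣}
  mul_mem' ha hb := ⟨mul_ne_zero ha.1 hb.1, ha.2.mul_left hb.2⟩
  one_mem' := ⟨one_ne_zero, isCoprime_one_left⟩

theorem mem_coprimeIdeals {I : Ideal (𝓞 F)} :
    I ∈ coprimeIdeals 𝔣 ↔ I ≠ ⊥ ∧ IsCoprime I 𝔣 := Iff.rfl

theorem mul_mem_coprimeIdeals_iff {I J : Ideal (𝓞 F)} :
    I * J ∈ coprimeIdeals 𝔣 ↔ I ∈ coprimeIdeals 𝔣 ∧ J ∈ coprimeIdeals 𝔣 := by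
  simp only [mem_coprimeIdeals, IsCoprime.mul_left_iff, ← Submodule.zero_eq_bot, mul_ne_zero_iff]
  tauto

variable (𝔣) in
/-- Equality of narrow ray classes as a congruence on the ideals coprime to `𝔣`. -/
def rayCon : Con (coprimeIdeals 𝔣) where
  r I J := SameNarrowRayClass F 𝔣 I J
  iseqv := ⟨fun _ => sameNarrowRayClass_refl _, sameNarrowRayClass_symm,
    sameNarrowRayClass_trans⟩
  mul' := sameNarrowRayClass_mul

variable (𝔣) in
/-- The narrow ray class group modulo `𝔣`. -/
abbrev RayClass : Type _ := (rayCon 𝔣).Quotient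

theorem rayClass_eq_iff {a b : coprimeIdeals 𝔣} :
    (a : RayClass 𝔣) = b ↔ SameNarrowRayClass F 𝔣 a b := (rayCon 𝔣).eq

variable (𝔣) in
/-- An even exponent killing the units modulo `𝔣`. -/
noncomputable def rayExponent : ℕ := 2 * Nat.card ((𝓞 F) ⧸ 𝔣)ˣ

theorem finite_quotient (h𝔣 : 𝔣 ≠ ⊥) : Finite ((𝓞 F) ⧸ 𝔣) :=
  Ideal.finiteQuotientOfFreeOfNeBot 𝔣 h𝔣

theorem rayExponent_pos (h𝔣 : 𝔣 ≠ ⊥) : 0 < rayExponent 𝔣 := by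
  have := finite_quotient h𝔣
  have : Finite ((𝓞 F) ⧸ 𝔣)ˣ := inferInstance
  exact mul_pos two_pos Nat.card_pos

theorem even_rayExponent : Even (rayExponent 𝔣) := even_two_mul _

theorem isUnit_mk_of_isCoprime {δ : 𝓞 F} (h : IsCoprime (Ideal.span {δ}) 𝔣) :
    IsUnit (Ideal.Quotient.mk 𝔣 δ) := by
  obtain ⟨x, hx, y, hy, hxy⟩ := Ideal.isCoprime_iff_exists.1 h
  obtain ⟨z, rfl⟩ := Ideal.mem_span_singleton.1 hx
  refine IsUnit.of_mul_eq_one (Ideal.Quotient.mk 𝔣 z) ?_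
  rw [← map_mul, ← map_one (Ideal.Quotient.mk 𝔣), Ideal.Quotient.mk_eq_mk_iff_sub_mem]
  rw [← hxy]
  simpa using hy

theorem mk_pow_rayExponent {δ : 𝓞 F} (h : IsUnit (Ideal.Quotient.mk 𝔣 δ)) :
    Ideal.Quotient.mk 𝔣 δ ^ rayExponent 𝔣 = 1 := by
  obtain ⟨u, hu⟩ := h
  rw [← hu, rayExponent, mul_comm, pow_mul, ← Units.val_pow_eq_pow_val, pow_card_eq_one']
  simp

theorem pow_rayExponent_sub_one_mem {δ : 𝓞 F} (h : IsUnit (Ideal.Quotient.mk 𝔣 δ)) :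
    δ ^ rayExponent 𝔣 - 1 ∈ 𝔣 := by
  rw [← Ideal.Quotient.mk_eq_mk_iff_sub_mem, map_pow, map_one, mk_pow_rayExponent h]

theorem isTotallyPositiveElem_pow {x : F} (hx : x ≠ 0) :
    IsTotallyPositiveElem F (x ^ rayExponent 𝔣) := fun φ => by
  rw [map_pow]
  exact even_rayExponent.pow_pos ((map_ne_zero φ).2 hx)


variable (𝔣) in
/-- The class of an ideal coprime to `𝔣` in the class group. -/
noncomputable def toClassGroup : coprimeIdeals 𝔣 →* ClassGroup (𝓞 F) :=
  ClassGroup.mk0.comp (Submonoid.inclusion fun _ hI => mem_nonZeroDivisors_iff_ne_zero.2 hI.1)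

theorem exists_generator {I : coprimeIdeals 𝔣} (h : toClassGroup 𝔣 I = 1) :
    ∃ δ : 𝓞 F, δ ≠ 0 ∧ IsUnit (Ideal.Quotient.mk 𝔣 δ) ∧ (I : Ideal (𝓞 F)) = Ideal.span {δ} := by
  obtain ⟨δ, hδ⟩ := ((ClassGroup.mk0_eq_one_iff _).1 h).principal
  rw [← Ideal.span] at hδ
  refine ⟨δ, ?_, isUnit_mk_of_isCoprime (hδ ▸ I.2.2), hδ⟩
  rintro rfl
  exact I.2.1 (hδ.trans (by simp))

theorem pow_mem_ray (I : coprimeIdeals 𝔣) :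
    ((I ^ (Nat.card (ClassGroup (𝓞 F)) * rayExponent 𝔣) : coprimeIdeals 𝔣) : RayClass 𝔣) = 1 := by
  obtain ⟨δ, h0, hu, hδ⟩ := exists_generator
    (I := I ^ Nat.card (ClassGroup (𝓞 F))) (by rw [map_pow, pow_card_eq_one'])
  refine rayClass_eq_iff.2 ⟨1, δ ^ rayExponent 𝔣, one_ne_zero, pow_ne_zero _ h0,
    by simpa using isTotallyPositiveElem_one, ?_, by simp, pow_rayExponent_sub_one_mem hu, ?_⟩
  · rw [map_pow]
    exact isTotallyPositiveElem_pow (by simpa using h0)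
  · rw [pow_mul, SubmonoidClass.coe_pow, hδ, Ideal.span_singleton_pow]
    simp

theorem rayClass_pow_eq_one (g : RayClass 𝔣) :
    g ^ (Nat.card (ClassGroup (𝓞 F)) * rayExponent 𝔣) = 1 := by
  obtain ⟨I, rfl⟩ := Con.mk'_surjective g
  exact pow_mem_ray I

/-- The narrow ray classes form a group. -/
noncomputable abbrev rayClassCommGroup (h𝔣 : 𝔣 ≠ ⊥) : CommGroup (RayClass 𝔣) where
  inv g := g ^ (Nat.card (ClassGroup (𝓞 F)) * rayExponent 𝔣 - 1)
  inv_mul_cancel g := by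
    change g ^ (Nat.card (ClassGroup (𝓞 F)) * rayExponent 𝔣 - 1) * g = 1
    have := Nat.mul_pos (Nat.card_pos (α := ClassGroup (𝓞 F))) (rayExponent_pos h𝔣)
    rw [← pow_succ, Nat.sub_add_cancel this, rayClass_pow_eq_one]

theorem sameNarrowRayClass_of_generators {I I' J : Ideal (𝓞 F)} (hJ : J ≠ ⊥) {δ δ' : 𝓞 F}
    (h0 : δ ≠ 0) (h0' : δ' ≠ 0) (hu : IsUnit (Ideal.Quotient.mk 𝔣 δ)) (hI : I * J = Ideal.span {δ})
    (hI' : I' * J = Ideal.span {δ'}) (hmk : Ideal.Quotient.mk 𝔣 δ = Ideal.Quotient.mk 𝔣 δ')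
    (hsgn : ∀ φ : F →+* ℝ, 0 < φ (algebraMap (𝓞 F) F δ) ↔ 0 < φ (algebraMap (𝓞 F) F δ'))
    (h𝔣 : 𝔣 ≠ ⊥) : SameNarrowRayClass F 𝔣 I I' := by
  obtain ⟨k, hk⟩ : ∃ k, rayExponent 𝔣 = k + 1 :=
    ⟨_, (Nat.sub_add_cancel (rayExponent_pos h𝔣)).symm⟩
  refine ⟨δ' * δ ^ k, δ ^ rayExponent 𝔣, mul_ne_zero h0' (pow_ne_zero _ h0), pow_ne_zero _ h0,
    fun φ => ?_, by rw [map_pow]; exact isTotallyPositiveElem_pow (by simpa using h0), ?_,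
    pow_rayExponent_sub_one_mem hu, ?_⟩
  · have h1 : 0 < φ (algebraMap (𝓞 F) F δ) ^ (k + 1) := by
      rw [← hk]
      exact even_rayExponent.pow_pos ((map_ne_zero φ).2 (by simpa using h0))
    rw [map_mul, map_pow, map_mul, map_pow]
    have hne' : φ (algebraMap (𝓞 F) F δ') ≠ 0 := (map_ne_zero φ).2 (by simpa using h0')
    have hne : φ (algebraMap (𝓞 F) F δ) ≠ 0 := (map_ne_zero φ).2 (by simpa using h0)
    rw [pow_succ'] at h1
    rcases lt_or_gt_of_ne hne with h | h
    · have h2 : φ (algebraMap (𝓞 F) F δ') < 0 :=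
        lt_of_le_of_ne (not_lt.1 fun h3 => (not_lt.2 h.le) ((hsgn φ).2 h3)) hne'
      exact mul_pos_of_neg_of_neg h2 (neg_of_mul_pos_right h1 h.le)
    · exact mul_pos ((hsgn φ).1 h) (pos_of_mul_pos_right h1 h.le)
  · rw [← Ideal.Quotient.mk_eq_mk_iff_sub_mem, map_mul, map_pow, ← hmk, ← pow_succ', ← hk,
      mk_pow_rayExponent hu, map_one]
  · refine mul_right_cancel₀ hJ ?_
    rw [mul_assoc, mul_assoc, hI, hI', Ideal.span_singleton_mul_span_singleton,
      Ideal.span_singleton_mul_span_singleton, hk]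
    congr 2
    ring

theorem finite_rayClass (h𝔣 : 𝔣 ≠ ⊥) : Finite (RayClass 𝔣) := by
  have := finite_quotient h𝔣
  set N := Nat.card (ClassGroup (𝓞 F))
  have hN : N ≠ 0 := Nat.card_pos.ne'
  obtain ⟨k, hk⟩ : ∃ k, N = k + 1 := Nat.exists_eq_succ_of_ne_zero hN
  let J : coprimeIdeals 𝔣 → coprimeIdeals 𝔣 := fun I =>
    Function.invFun (toClassGroup 𝔣) (toClassGroup 𝔣 I) ^ k
  have hJ : ∀ I, toClassGroup 𝔣 (I * J I) = 1 := fun I => by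
    have : toClassGroup 𝔣 (Function.invFun (toClassGroup 𝔣) (toClassGroup 𝔣 I)) =
        toClassGroup 𝔣 I := Function.apply_invFun_apply
    rw [map_mul, map_pow, this, ← pow_succ', ← hk, pow_card_eq_one']
  choose δ h0 hu hδ using fun I => exists_generator (hJ I)
  classical
  let inv : coprimeIdeals 𝔣 → ClassGroup (𝓞 F) × ((𝓞 F) ⧸ 𝔣) × ((F →+* ℝ) → Prop) := fun I =>
    (toClassGroup 𝔣 I, Ideal.Quotient.mk 𝔣 (δ I), fun φ => 0 < φ (algebraMap (𝓞 F) F (δ I)))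
  refine Finite.of_injective (fun g : RayClass 𝔣 => inv (Function.surjInv Con.mk'_surjective g))
    fun g g' hgg' => ?_
  rw [← Function.surjInv_eq (Con.mk'_surjective (c := rayCon 𝔣)) g,
    ← Function.surjInv_eq (Con.mk'_surjective (c := rayCon 𝔣)) g']
  set I := Function.surjInv (Con.mk'_surjective (c := rayCon 𝔣)) g
  set I' := Function.surjInv (Con.mk'_surjective (c := rayCon 𝔣)) g'
  simp only [inv, Prod.mk.injEq] at hgg'
  obtain ⟨h1, h2, h3⟩ := hgg'
  have hJJ : J I = J I' := congrArg (fun c => Function.invFun (toClassGroup 𝔣) c ^ k) h1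
  refine rayClass_eq_iff.2 (sameNarrowRayClass_of_generators (J I).2.1 (h0 I) (h0 I') (hu I)
    (hδ I) ?_ h2 (fun φ => iff_of_eq (congrFun h3 φ)) h𝔣)
  rw [hJJ]
  exact hδ I'

theorem sameNarrowRayClass_one_iff {I : Ideal (𝓞 F)} :
    SameNarrowRayClass F 𝔣 I 1 ↔ ∃ γ : 𝓞 F, γ ≠ 0 ∧
      IsTotallyPositiveElem F (algebraMap (𝓞 F) F γ) ∧ γ - 1 ∈ 𝔣 ∧ I = Ideal.span {γ} := by
  constructor
  · rintro ⟨α, β, h1, h2, h3, h4, h5, h6, h7⟩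
    rw [mul_one] at h7
    have hmem : β ∈ Ideal.span {α} := by
      have : β ∈ Ideal.span {α} * I := h7 ▸ Ideal.mem_span_singleton_self β
      exact (Ideal.mul_le_left : Ideal.span {α} * I ≤ Ideal.span {α}) this
    obtain ⟨γ, rfl⟩ := Ideal.mem_span_singleton.1 hmem
    refine ⟨γ, right_ne_zero_of_mul h2, fun φ => ?_, ?_, ?_⟩
    · have := h4 φ
      rw [map_mul, map_mul] at this
      exact pos_of_mul_pos_right this (h3 φ).le
    · have hα : Ideal.Quotient.mk 𝔣 α = 1 := by
        rwa [← map_one (Ideal.Quotient.mk 𝔣), Ideal.Quotient.mk_eq_mk_iff_sub_mem]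
      rw [← Ideal.Quotient.mk_eq_mk_iff_sub_mem, map_mul, map_one, hα, one_mul] at h6
      rw [← Ideal.Quotient.mk_eq_mk_iff_sub_mem, h6, map_one]
    · rw [← Ideal.span_singleton_mul_span_singleton] at h7
      exact mul_left_cancel₀ (by simpa using h1) h7
  · rintro ⟨γ, h0, h1, h2, rfl⟩
    exact ⟨1, γ, one_ne_zero, h0, by simpa using isTotallyPositiveElem_one, h1, by simp, h2,
      by simp⟩

end NarrowRay

namespace NarrowRay

/-- A smooth bump whose integer translates sum to `1`. -/
noncomputable def bump (t : ℝ) : ℝ := Real.smoothTransition (t + 1) - Real.smoothTransition t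

theorem bump_nonneg (t : ℝ) : 0 ≤ bump t :=
  sub_nonneg.2 (Real.smoothTransition.monotone (by linarith))

theorem abs_lt_one_of_bump_ne_zero {t : ℝ} (h : bump t ≠ 0) : |t| < 1 := by
  rw [abs_lt]
  constructor
  · by_contra! h'
    exact h (by rw [bump, Real.smoothTransition.zero_of_nonpos (by linarith),
      Real.smoothTransition.zero_of_nonpos (by linarith), sub_zero])
  · by_contra! h'
    exact h (by rw [bump, Real.smoothTransition.one_of_one_le (by linarith),
      Real.smoothTransition.one_of_one_le h', sub_self])

theorem contDiff_bump {n : ℕ∞} : ContDiff ℝ n bump :=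
  (Real.smoothTransition.contDiff.comp (contDiff_id.add contDiff_const)).sub
    Real.smoothTransition.contDiff

theorem sum_bump_range (x : ℝ) (N : ℕ) :
    ∑ j ∈ Finset.range N, bump (x + j) =
      Real.smoothTransition (x + N) - Real.smoothTransition x := by
  induction N with
  | zero => simp
  | succ N ih => rw [Finset.sum_range_succ, ih, bump]; push_cast; ring_nf

theorem exists_sum_bump (x : ℝ) : ∃ s : Finset ℤ,
    (∀ j ∉ s, bump (x + j) = 0) ∧ ∑ j ∈ s, bump (x + j) = 1 := by
  obtain ⟨A, hA⟩ := exists_nat_ge (|x| + 1)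
  have hx := abs_le.1 (le_refl |x|)
  refine ⟨(Finset.range (2 * A)).image fun j : ℕ => (j : ℤ) - A, fun j hj => ?_, ?_⟩
  · by_contra hne
    have h1 := abs_lt.1 (abs_lt_one_of_bump_ne_zero hne)
    have h2 : (j : ℝ) < A := by linarith
    have h3 : j < A := by exact_mod_cast h2
    have h4 : -(A : ℝ) < j := by linarith
    have h5 : -(A : ℤ) < j := by exact_mod_cast h4
    refine hj (Finset.mem_image.2 ⟨(j + A).toNat, ?_, ?_⟩)
    · rw [Finset.mem_range]
      omega
    · omega
  · rw [Finset.sum_image (fun _ _ _ _ h => by simpa using h)]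
    have := sum_bump_range (x - A) (2 * A)
    rw [Real.smoothTransition.one_of_one_le (by push_cast; linarith),
      Real.smoothTransition.zero_of_nonpos (by linarith), sub_zero] at this
    rw [← this]
    exact Finset.sum_congr rfl fun j _ => by push_cast; ring_nf

/-- A smooth bump on `ι → ℝ` whose integer translates sum to `1`. -/
noncomputable def piBump {ι : Type*} [Fintype ι] (x : ι → ℝ) : ℝ := ∏ i, bump (x i)

theorem piBump_nonneg {ι : Type*} [Fintype ι] (x : ι → ℝ) : 0 ≤ piBump x :=
  Finset.prod_nonneg fun _ _ => bump_nonneg _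

theorem hasSum_piBump {ι : Type*} [Fintype ι] (x : ι → ℝ) :
    HasSum (fun f : ι → ℤ => piBump (x + fun i => (f i : ℝ))) 1 := by
  classical
  choose s hs hs1 using fun i => exists_sum_bump (x i)
  have h : ∑ f ∈ Fintype.piFinset s, piBump (x + fun i => (f i : ℝ)) = 1 := by
    simp only [piBump, Pi.add_apply]
    rw [← Finset.prod_univ_sum s fun i j => bump (x i + (j : ℝ))]
    exact Finset.prod_eq_one fun i _ => hs1 i
  rw [← h]
  refine hasSum_sum_of_ne_finset_zero fun f hf => ?_
  rw [Fintype.mem_piFinset, not_forall] at hf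
  obtain ⟨i, hi⟩ := hf
  exact Finset.prod_eq_zero (Finset.mem_univ i) (hs i _ hi)

variable {F : Type*} [Field F] [NumberField F] (𝔣 : Ideal (𝓞 F))

open NumberField.Units NumberField.Units.dirichletUnitTheorem Module

/-- The totally positive units congruent to `1` modulo `𝔣`. -/
def rayUnits : Subgroup (𝓞 F)ˣ where
  carrier := {u | IsTotallyPositiveElem F (algebraMap (𝓞 F) F u) ∧ (u : 𝓞 F) - 1 ∈ 𝔣}
  mul_mem' {u v} hu hv := ⟨by
    rw [Units.val_mul, map_mul]; exact isTotallyPositiveElem_mul hu.1 hv.1, by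
    rw [Units.val_mul]; exact mul_sub_one_mem hu.2 hv.2⟩
  one_mem' := ⟨by simpa using isTotallyPositiveElem_one, by simp⟩
  inv_mem' {u} hu := ⟨fun φ => by
    have h1 := hu.1 φ
    have h2 : φ (algebraMap (𝓞 F) F u) * φ (algebraMap (𝓞 F) F (u⁻¹ : (𝓞 F)ˣ)) = 1 := by
      rw [← map_mul, ← map_mul, Units.mul_inv, map_one, map_one]
    exact pos_of_mul_pos_right (h2 ▸ one_pos) h1.le, by
    have : ((u⁻¹ : (𝓞 F)ˣ) : 𝓞 F) - 1 = -((u⁻¹ : (𝓞 F)ˣ) : 𝓞 F) * (u - 1) := by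
      rw [neg_mul, mul_sub, Units.inv_mul]; ring
    rw [this]
    exact 𝔣.mul_mem_left _ hu.2⟩

variable {𝔣} in
theorem mem_rayUnits {u : (𝓞 F)ˣ} : u ∈ rayUnits 𝔣 ↔
    IsTotallyPositiveElem F (algebraMap (𝓞 F) F u) ∧ (u : 𝓞 F) - 1 ∈ 𝔣 := Iff.rfl

theorem zpow_rayExponent_mem (u : (𝓞 F)ˣ) : u ^ rayExponent 𝔣 ∈ rayUnits 𝔣 := by
  rw [mem_rayUnits, Units.val_pow_eq_pow_val, map_pow]
  exact ⟨isTotallyPositiveElem_pow (by simp), pow_rayExponent_sub_one_mem (u.isUnit.map _)⟩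

/-- The powers of the fundamental units that are visibly in `rayUnits`. -/
noncomputable def fundPow : Multiplicative (Fin (rank F) → ℤ) →* rayUnits 𝔣 where
  toFun f := ⟨(∏ i, fundSystem F i ^ f.toAdd i) ^ rayExponent 𝔣, zpow_rayExponent_mem 𝔣 _⟩
  map_one' := by ext; simp
  map_mul' f g := by
    ext1
    simp only [toAdd_mul, Pi.add_apply, zpow_add, Finset.prod_mul_distrib, mul_pow,
      Subgroup.coe_mul]

open scoped Classical in
variable (F) in
/-- The basis of the logarithmic space given by the fundamental units. -/
noncomputable def logBasis : Basis (Fin (rank F)) ℝ (logSpace F) :=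
  (basisUnitLattice F).ofZLatticeBasis ℝ _

theorem logBasis_apply (i : Fin (rank F)) :
    logBasis F i = logEmbedding F (Additive.ofMul (fundSystem F i)) := by
  classical
  rw [logEmbedding_fundSystem]
  exact Basis.ofZLatticeBasis_apply ..

/-- Coordinates on the logarithmic space with respect to the multiples by `rayExponent 𝔣`
of the fundamental units. -/
noncomputable def logCoord : logSpace F →ₗ[ℝ] (Fin (rank F) → ℝ) :=
  (rayExponent 𝔣 : ℝ)⁻¹ • (logBasis F).equivFun.toLinearMap

theorem logCoord_fundPow (h𝔣 : 𝔣 ≠ ⊥) (f : Multiplicative (Fin (rank F) → ℤ)) :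
    logCoord 𝔣 (logEmbedding F (Additive.ofMul (fundPow 𝔣 f : (𝓞 F)ˣ))) =
      fun i => ((f.toAdd i : ℤ) : ℝ) := by
  have h0 : (rayExponent 𝔣 : ℝ) ≠ 0 := Nat.cast_ne_zero.2 (rayExponent_pos h𝔣).ne'
  have h1 : logEmbedding F (Additive.ofMul (fundPow 𝔣 f : (𝓞 F)ˣ)) =
      (rayExponent 𝔣 : ℝ) • ∑ i, ((f.toAdd i : ℤ) : ℝ) •
        logBasis F i := by
    simp only [fundPow, MonoidHom.coe_mk, OneHom.coe_mk, ofMul_pow, ofMul_prod, ofMul_zpow,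
      map_nsmul, map_sum, map_zsmul, logBasis_apply,
      Nat.cast_smul_eq_nsmul, Int.cast_smul_eq_zsmul]
  rw [h1, map_smul, logCoord, LinearMap.smul_apply, smul_inv_smul₀ h0]
  ext j
  simp [Finsupp.single_apply]

theorem fundPow_injective (h𝔣 : 𝔣 ≠ ⊥) : Function.Injective (fundPow 𝔣) := fun f g h => by
  have := (logCoord_fundPow 𝔣 h𝔣 f).symm.trans ((congrArg (fun u : rayUnits 𝔣 =>
    logCoord 𝔣 (logEmbedding F (Additive.ofMul (u : (𝓞 F)ˣ)))) h).trans (logCoord_fundPow 𝔣 h𝔣 g))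
  exact Multiplicative.toAdd.injective (funext fun i => Int.cast_injective (congrFun this i))

theorem finite_rayUnits_quotient (h𝔣 : 𝔣 ≠ ⊥) : Finite (rayUnits 𝔣 ⧸ (fundPow 𝔣).range) := by
  have : NeZero (rayExponent 𝔣) := ⟨(rayExponent_pos h𝔣).ne'⟩
  choose ζe hζe _ using fun u : rayUnits 𝔣 => exist_unique_eq_mul_prod F (u : (𝓞 F)ˣ)
  refine Finite.of_injective (fun q : rayUnits 𝔣 ⧸ (fundPow 𝔣).range =>
    (((ζe q.out).1, fun i => ((ζe q.out).2 i : ZMod (rayExponent 𝔣))) :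
      torsion F × (Fin (rank F) → ZMod (rayExponent 𝔣)))) fun q q' h => ?_
  simp only [Prod.mk.injEq] at h
  obtain ⟨h1, h2⟩ := h
  have h3 : ∀ i, ∃ f : ℤ, (ζe q'.out).2 i = (ζe q.out).2 i + rayExponent 𝔣 * f := fun i => by
    obtain ⟨f, hf⟩ := (ZMod.intCast_eq_intCast_iff_dvd_sub _ _ _).1 (congrFun h2 i)
    exact ⟨f, by rw [← hf]; ring⟩
  choose f hf using h3
  rw [← q.out_eq', ← q'.out_eq']
  refine QuotientGroup.eq.2 ⟨Multiplicative.ofAdd f, ?_⟩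
  ext1
  rw [Subgroup.coe_mul, Subgroup.coe_inv, eq_inv_mul_iff_mul_eq, hζe q.out, hζe q'.out, ← h1]
  simp only [hf, fundPow, MonoidHom.coe_mk, OneHom.coe_mk, toAdd_ofAdd, zpow_add,
    Finset.prod_mul_distrib, mul_assoc, ← Finset.prod_pow]
  simp only [← zpow_natCast, ← zpow_mul, mul_comm]

theorem bijective_out_mul_fundPow (h𝔣 : 𝔣 ≠ ⊥) : Function.Bijective
    fun p : (rayUnits 𝔣 ⧸ (fundPow 𝔣).range) × Multiplicative (Fin (rank F) → ℤ) =>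
      p.1.out * fundPow 𝔣 p.2 := by
  constructor
  · rintro ⟨q, f⟩ ⟨q', f'⟩ h
    have h' : q.out * fundPow 𝔣 f = q'.out * fundPow 𝔣 f' := h
    have h1 : q = q' := by
      rw [← q.out_eq', ← q'.out_eq']
      refine QuotientGroup.eq.2 ⟨f * f'⁻¹, ?_⟩
      rw [map_mul, map_inv, mul_inv_eq_iff_eq_mul, mul_assoc, ← h', inv_mul_cancel_left]
    subst h1
    rw [fundPow_injective 𝔣 h𝔣 (mul_left_cancel h')]
  · intro u
    obtain ⟨f, hf⟩ : ((u : rayUnits 𝔣 ⧸ (fundPow 𝔣).range).out)⁻¹ * u ∈ (fundPow 𝔣).range :=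
      QuotientGroup.eq.1 (QuotientGroup.out_eq' _)
    exact ⟨(u, f), by simp only [hf, mul_inv_cancel_left]⟩

theorem hasSum_rayUnits (h𝔣 : 𝔣 ≠ ⊥) (x : Fin (rank F) → ℝ) :
    HasSum (fun u : rayUnits 𝔣 =>
      piBump (x + logCoord 𝔣 (logEmbedding F (Additive.ofMul (u : (𝓞 F)ˣ)))))
      (Nat.card (rayUnits 𝔣 ⧸ (fundPow 𝔣).range)) := by
  have := finite_rayUnits_quotient 𝔣 h𝔣
  have : Fintype (rayUnits 𝔣 ⧸ (fundPow 𝔣).range) := Fintype.ofFinite _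
  let e := Equiv.ofBijective _ (bijective_out_mul_fundPow 𝔣 h𝔣)
  set g : rayUnits 𝔣 → ℝ := fun u =>
    piBump (x + logCoord 𝔣 (logEmbedding F (Additive.ofMul (u : (𝓞 F)ˣ))))
  rw [← e.hasSum_iff]
  have h1 : ∀ q, HasSum (fun f => (g ∘ e) (q, f)) 1 := fun q => by
    have h2 := hasSum_piBump (x + logCoord 𝔣 (logEmbedding F (Additive.ofMul (q.out : (𝓞 F)ˣ))))
    rw [← Multiplicative.toAdd.hasSum_iff] at h2
    convert! h2 using 2 with f
    have h3 : e (q, f) = q.out * fundPow 𝔣 f := rfl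
    simp only [Function.comp_apply, h3, g, Subgroup.coe_mul, ofMul_mul, map_add,
      logCoord_fundPow 𝔣 h𝔣 f, add_assoc]
  have hs := (summable_prod_of_nonneg (f := g ∘ e) (fun _ => piBump_nonneg _)).2
    ⟨fun q => (h1 q).summable, (hasSum_fintype _).summable⟩
  have h4 := hs.hasSum.prod_fiberwise h1
  have h5 := h4.unique (hasSum_fintype _)
  rw [Finset.sum_const, Finset.card_univ, nsmul_eq_mul, mul_one, ← Nat.card_eq_fintype_card] at h5
  rw [← h5]
  exact hs.hasSum

end NarrowRay

namespace NarrowRay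

variable {F : Type*} [Field F] [NumberField F] (𝔣 : Ideal (𝓞 F))

open NumberField.Units NumberField.Units.dirichletUnitTheorem Module
open NumberField.mixedEmbedding NumberField.InfinitePlace
open scoped ContDiff Classical

/-- A smooth weight on the mixed space which is a partition of unity
under the action of `rayUnits 𝔣`, supported on the totally positive part. -/
noncomputable def testFun (W : ℝ → ℝ) (y : mixedSpace F) : ℝ :=
  if ∀ w, 0 < y.1 w then W (mixedEmbedding.norm y) * piBump (logCoord 𝔣 (logMap y)) else 0

variable {𝔣}

theorem exists_norm_le_of_logCoord (h𝔣 : 𝔣 ≠ ⊥) : ∃ B : ℝ, 0 ≤ B ∧ ∀ v : logSpace F,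
    (∀ i, |logCoord 𝔣 v i| < 1) → ‖v‖ ≤ B := by
  have h0 : (rayExponent 𝔣 : ℝ) ≠ 0 := Nat.cast_ne_zero.2 (rayExponent_pos h𝔣).ne'
  let L := (logBasis F).equivFun.symm.toLinearMap.toContinuousLinearMap
  refine ⟨‖L‖ * rayExponent 𝔣, by positivity, fun v hv => ?_⟩
  have h1 : v = L ((rayExponent 𝔣 : ℝ) • logCoord 𝔣 v) := by
    simp only [logCoord, LinearMap.smul_apply, smul_inv_smul₀ h0, L]
    simp
  calc ‖v‖ = ‖L ((rayExponent 𝔣 : ℝ) • logCoord 𝔣 v)‖ := by rw [← h1]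
    _ ≤ ‖L‖ * ‖(rayExponent 𝔣 : ℝ) • logCoord 𝔣 v‖ := L.le_opNorm _
    _ ≤ ‖L‖ * (rayExponent 𝔣 * 1) := by
      gcongr
      rw [_root_.norm_smul, Real.norm_natCast]
      gcongr
      exact (pi_norm_le_iff_of_nonneg zero_le_one).2 fun i => (hv i).le
    _ = _ := by rw [mul_one]

theorem abs_log_normAtPlace_le {A B : ℝ} {y : mixedSpace F} (hy : mixedEmbedding.norm y ≠ 0)
    (hA : |Real.log (mixedEmbedding.norm y)| ≤ A) (hB : ‖logMap y‖ ≤ B) (w : InfinitePlace F) :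
    |Real.log (normAtPlace w y)| ≤ (A + B) + Fintype.card (InfinitePlace F) * (2 * (A + B)) := by
  classical
  have hA0 : 0 ≤ A := (abs_nonneg _).trans hA
  have hB0 : 0 ≤ B := (norm_nonneg _).trans hB
  have hm : ∀ w : InfinitePlace F, (1 : ℝ) ≤ mult w ∧ (mult w : ℝ) ≤ 2 := fun w => by
    rw [mult]; split_ifs <;> norm_num
  have h1 : ∀ w : InfinitePlace F, w ≠ w₀ → |Real.log (normAtPlace w y)| ≤ A + B := fun w hw => by
    have h2 := (norm_le_pi_norm (logMap y) ⟨w, hw⟩).trans hB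
    rw [logMap_apply, norm_mul, Real.norm_natCast, Real.norm_eq_abs] at h2
    have h3 : |Real.log (normAtPlace w y) -
        Real.log (mixedEmbedding.norm y) * (finrank ℚ F : ℝ)⁻¹| ≤ B :=
      (le_mul_of_one_le_left (abs_nonneg _) (hm w).1).trans h2
    have h4 : |Real.log (mixedEmbedding.norm y) * (finrank ℚ F : ℝ)⁻¹| ≤ A := by
      rw [abs_mul, abs_of_nonneg (by positivity : (0 : ℝ) ≤ (finrank ℚ F : ℝ)⁻¹)]
      exact (mul_le_of_le_one_right (abs_nonneg _)
        (inv_le_one_of_one_le₀ (by exact_mod_cast finrank_pos))).trans hA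
    have h5 := abs_add_le (Real.log (normAtPlace w y) -
        Real.log (mixedEmbedding.norm y) * (finrank ℚ F : ℝ)⁻¹)
        (Real.log (mixedEmbedding.norm y) * (finrank ℚ F : ℝ)⁻¹)
    rw [sub_add_cancel] at h5
    linarith
  by_cases hw : w = w₀
  · subst hw
    have h2 : Real.log (mixedEmbedding.norm y) =
        ∑ w, (mult w : ℝ) * Real.log (normAtPlace w y) := by
      rw [mixedEmbedding.norm_apply, Real.log_prod fun w _ =>
        pow_ne_zero _ (mixedEmbedding.norm_ne_zero_iff.1 hy w)]
      simp only [Real.log_pow]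
    rw [← Finset.add_sum_erase _ _ (Finset.mem_univ (w₀ : InfinitePlace F))] at h2
    have h3 : |∑ w ∈ Finset.univ.erase (w₀ : InfinitePlace F),
        (mult w : ℝ) * Real.log (normAtPlace w y)| ≤
        Fintype.card (InfinitePlace F) * (2 * (A + B)) := by
      refine (Finset.abs_sum_le_sum_abs _ _).trans ((Finset.sum_le_card_nsmul _ _
        (2 * (A + B)) fun w hw => ?_).trans ?_)
      · rw [abs_mul, Nat.abs_cast]
        exact mul_le_mul (hm w).2 (h1 w (Finset.ne_of_mem_erase hw)) (abs_nonneg _) (by norm_num)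
      · rw [nsmul_eq_mul]
        gcongr
        exact Finset.card_le_univ _
    have h4 : |(mult (w₀ : InfinitePlace F) : ℝ) * Real.log (normAtPlace w₀ y)| ≤
        A + Fintype.card (InfinitePlace F) * (2 * (A + B)) := by
      rw [← sub_eq_iff_eq_add] at h2
      rw [← h2]
      exact (abs_sub _ _).trans (add_le_add hA h3)
    rw [abs_mul, Nat.abs_cast] at h4
    have := (le_mul_of_one_le_left (abs_nonneg (Real.log (normAtPlace w₀ y)))
      (hm (w₀ : InfinitePlace F)).1).trans h4
    linarith
  · exact (h1 w hw).trans (le_add_of_nonneg_right (by positivity))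

theorem exists_normAtPlace_bounds (h𝔣 : 𝔣 ≠ ⊥) {W : ℝ → ℝ} {a b : ℝ} (ha : 0 < a)
    (hW : ∀ x, W x ≠ 0 → x ∈ Set.Icc a b) : ∃ c C : ℝ, 0 < c ∧ ∀ y : mixedSpace F,
      testFun 𝔣 W y ≠ 0 → ((∀ w, c ≤ normAtPlace w y ∧ normAtPlace w y ≤ C) ∧
        ∀ w, 0 ≤ y.1 w) := by
  obtain ⟨B, hB0, hB⟩ := exists_norm_le_of_logCoord h𝔣
  set A := max |Real.log a| |Real.log b|
  set M := (A + B) + Fintype.card (InfinitePlace F) * (2 * (A + B))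
  refine ⟨Real.exp (-M), Real.exp M, Real.exp_pos _, fun y hy => ?_⟩
  rw [testFun] at hy
  split_ifs at hy with hpos
  · refine ⟨fun w => ?_, fun w => (hpos w).le⟩
    have h1 := hW _ (left_ne_zero_of_mul hy)
    have h2 : ∀ i, |logCoord 𝔣 (logMap y) i| < 1 := fun i =>
      abs_lt_one_of_bump_ne_zero
        (Finset.prod_ne_zero_iff.1 (right_ne_zero_of_mul hy) i (Finset.mem_univ i))
    have hN : 0 < mixedEmbedding.norm y := ha.trans_le h1.1
    have h3 := abs_log_normAtPlace_le (A := A) hN.ne'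
      (by
        rw [abs_le]
        have h4 := Real.log_le_log ha h1.1
        have h5 := Real.log_le_log hN h1.2
        have h6 := neg_abs_le (Real.log a)
        have h7 := le_abs_self (Real.log b)
        have h8 : |Real.log a| ≤ A := le_max_left _ _
        have h9 : |Real.log b| ≤ A := le_max_right _ _
        constructor <;> linarith) (hB _ h2) w
    have h4 : 0 < normAtPlace w y := (normAtPlace_nonneg w y).lt_of_ne'
      (mixedEmbedding.norm_ne_zero_iff.1 hN.ne' w)
    exact ⟨(Real.le_log_iff_exp_le h4).1 (abs_le.1 h3).1,
      (Real.log_le_iff_le_exp h4).1 (abs_le.1 h3).2⟩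
  · exact absurd rfl hy

theorem isCompact_normAtPlace (c C : ℝ) :
    IsCompact {y : mixedSpace F | (∀ w, c ≤ normAtPlace w y ∧ normAtPlace w y ≤ C) ∧
      ∀ w, 0 ≤ y.1 w} := by
  refine Metric.isCompact_of_isClosed_isBounded ?_ ?_
  · refine IsClosed.and ?_ ?_
    · simp only [Set.ofPred_forall]
      refine isClosed_iInter fun w => (isClosed_le continuous_const (continuous_normAtPlace w)).inter
        (isClosed_le (continuous_normAtPlace w) continuous_const)
    · simp only [Set.ofPred_forall]
      exact isClosed_iInter fun w => isClosed_le continuous_const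
        ((continuous_apply w).comp continuous_fst)
  · refine (Metric.isBounded_closedBall (x := (0 : mixedSpace F)) (r := C)).subset fun y hy => ?_
    rw [mem_closedBall_zero_iff]
    rw [mixedEmbedding.norm_eq_sup'_normAtPlace]
    exact Finset.sup'_le _ _ fun w _ => (hy.1 w).2

theorem contDiffAt_normAtPlace {w : InfinitePlace F} {y : mixedSpace F}
    (hy : normAtPlace w y ≠ 0) : ContDiffAt ℝ ∞ (fun y => normAtPlace w y) y := by
  by_cases hw : IsReal w
  · have h : (fun y : mixedSpace F => normAtPlace w y) = fun y => ‖y.1 ⟨w, hw⟩‖ :=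
      funext fun y => normAtPlace_apply_of_isReal hw y
    rw [h]
    rw [normAtPlace_apply_of_isReal hw] at hy
    exact ContDiffAt.norm ℝ ((contDiff_apply ℝ ℝ _).comp contDiff_fst).contDiffAt
      (norm_ne_zero_iff.1 hy)
  · rw [not_isReal_iff_isComplex] at hw
    have h : (fun y : mixedSpace F => normAtPlace w y) = fun y => ‖y.2 ⟨w, hw⟩‖ :=
      funext fun y => normAtPlace_apply_of_isComplex hw y
    rw [h]
    rw [normAtPlace_apply_of_isComplex hw] at hy
    exact ContDiffAt.norm ℝ ((contDiff_apply ℝ ℂ _).comp contDiff_snd).contDiffAt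
      (norm_ne_zero_iff.1 hy)

theorem contDiffAt_norm {y : mixedSpace F} (hy : mixedEmbedding.norm y ≠ 0) :
    ContDiffAt ℝ ∞ (fun y : mixedSpace F => mixedEmbedding.norm y) y := by
  simp only [mixedEmbedding.norm_apply]
  exact contDiffAt_prod fun w _ =>
    (contDiffAt_normAtPlace (mixedEmbedding.norm_ne_zero_iff.1 hy w)).pow _

theorem contDiffAt_logMap {y : mixedSpace F} (hy : mixedEmbedding.norm y ≠ 0) :
    ContDiffAt ℝ ∞ (logMap : mixedSpace F → logSpace F) y := by
  refine contDiffAt_pi.2 fun w => ?_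
  simp only [logMap_apply]
  have h := mixedEmbedding.norm_ne_zero_iff.1 hy w
  exact contDiffAt_const.mul (((contDiffAt_normAtPlace h).log h).sub
    (((contDiffAt_norm hy).log hy).mul contDiffAt_const))

theorem contDiff_piBump {ι : Type*} [Fintype ι] : ContDiff ℝ ∞ (piBump : (ι → ℝ) → ℝ) :=
  contDiff_prod fun i _ => contDiff_bump.comp (contDiff_apply ℝ ℝ i)

theorem hasCompactSupport_testFun (h𝔣 : 𝔣 ≠ ⊥) {W : ℝ → ℝ} {a b : ℝ} (ha : 0 < a)
    (hW : ∀ x, W x ≠ 0 → x ∈ Set.Icc a b) : HasCompactSupport (testFun (F := F) 𝔣 W) := by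
  obtain ⟨c, C, -, h⟩ := exists_normAtPlace_bounds h𝔣 ha hW
  exact HasCompactSupport.intro (isCompact_normAtPlace c C) fun y hy =>
    by_contra fun hne => hy (h y hne)

theorem contDiff_testFun (h𝔣 : 𝔣 ≠ ⊥) {W : ℝ → ℝ} {a b : ℝ} (ha : 0 < a)
    (hW : ∀ x, W x ≠ 0 → x ∈ Set.Icc a b) (hWs : ContDiff ℝ ∞ W) :
    ContDiff ℝ ∞ (testFun (F := F) 𝔣 W) := by
  obtain ⟨c, C, hc, h⟩ := exists_normAtPlace_bounds h𝔣 ha hW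
  refine contDiff_iff_contDiffAt.2 fun y => ?_
  by_cases hy : (∀ w, c ≤ normAtPlace w y ∧ normAtPlace w y ≤ C) ∧ ∀ w, 0 ≤ y.1 w
  · have hN : mixedEmbedding.norm y ≠ 0 :=
      mixedEmbedding.norm_ne_zero_iff.2 fun w => (hc.trans_le (hy.1 w).1).ne'
    have hpos : ∀ w, 0 < y.1 w := fun w => (hy.2 w).lt_of_ne' fun h0 => by
      have := (hy.1 w.1).1
      rw [normAtPlace_apply_of_isReal w.2, h0, norm_zero] at this
      linarith
    have hev : testFun 𝔣 W =ᶠ[nhds y] fun y =>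
        W (mixedEmbedding.norm y) * piBump (logCoord 𝔣 (logMap y)) := by
      have : ∀ᶠ y' : mixedSpace F in nhds y, ∀ w, 0 < y'.1 w :=
        Filter.eventually_all.2 fun w =>
          ((continuous_apply w).comp continuous_fst).continuousAt.eventually (lt_mem_nhds (hpos w))
      filter_upwards [this] with y' hy'
      rw [testFun, if_pos hy']
    refine ContDiffAt.congr_of_eventuallyEq ?_ hev
    exact (hWs.contDiffAt.comp y (contDiffAt_norm hN)).mul
      (contDiff_piBump.contDiffAt.comp y
        ((logCoord 𝔣).toContinuousLinearMap.contDiff.contDiffAt.comp y (contDiffAt_logMap hN)))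
  · have hev : testFun 𝔣 W =ᶠ[nhds y] fun _ => 0 := by
      filter_upwards [(isCompact_normAtPlace c C).isClosed.isOpen_compl.mem_nhds hy] with y' hy'
      exact by_contra fun hne => hy' (h y' hne)
    exact contDiffAt_const.congr_of_eventuallyEq hev

end NarrowRay

namespace NarrowRay

variable {F : Type*} [Field F] [NumberField F] {𝔣 : Ideal (𝓞 F)}

open NumberField.Units NumberField.Units.dirichletUnitTheorem Module
open NumberField.mixedEmbedding NumberField.InfinitePlace
open scoped ContDiff Classical

theorem isTotallyPositiveElem_iff {x : F} : IsTotallyPositiveElem F x ↔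
    ∀ w, 0 < (mixedEmbedding F x).1 w := by
  simp only [mixedEmbedding_apply_isReal]
  constructor
  · exact fun h w => h _
  · intro h φ
    have hφ : ComplexEmbedding.IsReal ((algebraMap ℝ ℂ).comp φ) := by
      ext; simp
    have h1 := h ⟨InfinitePlace.mk _, isReal_mk_iff.2 hφ⟩
    have h2 := embedding_of_isReal_apply (isReal_mk_iff.2 hφ) x
    rw [embedding_mk_eq_of_isReal hφ] at h2
    have h3 : embedding_of_isReal (isReal_mk_iff.2 hφ) x = φ x := by
      exact Complex.ofReal_injective h2
    rw [← h3]
    exact h1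

theorem testFun_nonneg {W : ℝ → ℝ} (hW : ∀ x, 0 ≤ W x) (y : mixedSpace F) :
    0 ≤ testFun 𝔣 W y := by
  rw [testFun]
  split_ifs
  · exact mul_nonneg (hW _) (piBump_nonneg _)
  · exact le_rfl

theorem isTotallyPositiveElem_of_testFun_ne_zero {W : ℝ → ℝ} {x : F} {t : ℝ} (ht : 0 < t)
    (h : testFun 𝔣 W (t • mixedEmbedding F x) ≠ 0) : IsTotallyPositiveElem F x := by
  rw [testFun] at h
  split_ifs at h with hp
  · exact isTotallyPositiveElem_iff.2 fun w => (mul_pos_iff_of_pos_left ht).1 (hp w)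
  · exact absurd rfl h

theorem norm_mixedEmbedding (γ : 𝓞 F) :
    mixedEmbedding.norm (mixedEmbedding F (algebraMap (𝓞 F) F γ)) =
      (Ideal.absNorm (Ideal.span {γ}) : ℝ) := by
  rw [norm_eq_norm, Ideal.absNorm_span_singleton, ← Algebra.coe_norm_int]
  simp [Nat.cast_natAbs]

theorem hasSum_testFun (h𝔣 : 𝔣 ≠ ⊥) (W : ℝ → ℝ) {γ : 𝓞 F} (hγ0 : γ ≠ 0)
    (hγ : IsTotallyPositiveElem F (algebraMap (𝓞 F) F γ)) {t : ℝ} (ht : 0 < t) :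
    HasSum (fun u : rayUnits 𝔣 =>
      testFun 𝔣 W (t • mixedEmbedding F (algebraMap (𝓞 F) F ((u : (𝓞 F)ˣ) * γ))))
      (Nat.card (rayUnits 𝔣 ⧸ (fundPow 𝔣).range) *
        W (t ^ finrank ℚ F * Ideal.absNorm (Ideal.span {γ}))) := by
  have hN : mixedEmbedding.norm (mixedEmbedding F (algebraMap (𝓞 F) F γ)) ≠ 0 := by
    rw [norm_mixedEmbedding, Nat.cast_ne_zero, Ne, Ideal.absNorm_eq_zero_iff,
      Ideal.span_singleton_eq_bot]
    exact hγ0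
  have hNu : ∀ u : (𝓞 F)ˣ,
      mixedEmbedding.norm (mixedEmbedding F (algebraMap (𝓞 F) F (u * γ))) =
      Ideal.absNorm (Ideal.span {γ}) := fun u => by
    rw [norm_mixedEmbedding, Ideal.span_singleton_mul_left_unit u.isUnit]
  convert! (hasSum_rayUnits 𝔣 h𝔣
    (logCoord 𝔣 (logMap (mixedEmbedding F (algebraMap (𝓞 F) F γ))))).mul_right
    (W (t ^ finrank ℚ F * Ideal.absNorm (Ideal.span {γ}))) using 2 with u
  have hp : IsTotallyPositiveElem F (algebraMap (𝓞 F) F ((u : (𝓞 F)ˣ) * γ)) := by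
    rw [map_mul]
    exact isTotallyPositiveElem_mul u.2.1 hγ
  have hp' : ∀ w, 0 < (t • mixedEmbedding F (algebraMap (𝓞 F) F ((u : (𝓞 F)ˣ) * γ))).1 w :=
    fun w => mul_pos ht (isTotallyPositiveElem_iff.1 hp w)
  rw [testFun, if_pos hp', mixedEmbedding.norm_smul, abs_of_pos ht, hNu, mul_comm]
  congr 2
  rw [logMap_real_smul (by rw [hNu, ← norm_mixedEmbedding]; exact hN) ht.ne', map_mul, map_mul,
    logMap_mul (by rw [← RingOfIntegers.coe_eq_algebraMap, norm_unit]; exact one_ne_zero) hN,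
    ← map_add, add_comm, ← RingOfIntegers.coe_eq_algebraMap, logMap_eq_logEmbedding]

theorem card_rayUnits_quotient_pos (h𝔣 : 𝔣 ≠ ⊥) :
    0 < Nat.card (rayUnits 𝔣 ⧸ (fundPow 𝔣).range) := by
  have := finite_rayUnits_quotient 𝔣 h𝔣
  exact Nat.card_pos

open MeasureTheory in
theorem integral_testFun_pos (h𝔣 : 𝔣 ≠ ⊥) {W : ℝ → ℝ} {a b : ℝ} (ha : 0 < a)
    (hW : ∀ x, W x ≠ 0 → x ∈ Set.Icc a b) (hWs : ContDiff ℝ ∞ W) (hW0 : ∀ x, 0 ≤ W x)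
    {x₀ : ℝ} (hx₀ : W x₀ ≠ 0) : 0 < ∫ y : mixedSpace F, testFun 𝔣 W y := by
  have hx : 0 < x₀ := ha.trans_le (hW _ hx₀).1
  obtain ⟨u, hu⟩ : ∃ u : rayUnits 𝔣, testFun 𝔣 W ((x₀ ^ (finrank ℚ F : ℝ)⁻¹) •
      mixedEmbedding F (algebraMap (𝓞 F) F ((u : (𝓞 F)ˣ) * 1))) ≠ 0 := by
    by_contra! h
    have h1 := hasSum_testFun h𝔣 W one_ne_zero (by simpa using isTotallyPositiveElem_one)
      (Real.rpow_pos_of_pos hx (finrank ℚ F : ℝ)⁻¹)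
    simp only [h] at h1
    have h2 := h1.unique hasSum_zero
    rw [Real.rpow_inv_natCast_pow hx.le finrank_pos.ne'] at h2
    simp [hx₀, (card_rayUnits_quotient_pos h𝔣).ne'] at h2
  exact (contDiff_testFun h𝔣 ha hW hWs).continuous.integral_pos_of_hasCompactSupport_nonneg_nonzero
    (hasCompactSupport_testFun h𝔣 ha hW) (testFun_nonneg hW0) hu

end NarrowRay

namespace NarrowRay

variable {F : Type*} [Field F] [NumberField F] {𝔣 : Ideal (𝓞 F)}

open NumberField.mixedEmbedding NumberField.InfinitePlace Module MeasureTheory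
open scoped ContDiff Classical nonZeroDivisors

variable (F) in
/-- The covolume of the ring of integers in the mixed space. -/
noncomputable def covolumeConst : ℝ := volume.real (ZSpan.fundamentalDomain (latticeBasis F))

theorem covolumeConst_pos : 0 < covolumeConst F :=
  ENNReal.toReal_pos (ZSpan.measure_fundamentalDomain_ne_zero _)
    (ZSpan.fundamentalDomain_isBounded _).measure_lt_top.ne

theorem exists_hasSum_coset_le {Ψ : mixedSpace F → ℝ} (hΨ : ContDiff ℝ ∞ Ψ)
    (hc : HasCompactSupport Ψ) {J : Ideal (𝓞 F)} (hJ : J ≠ ⊥) (k : ℕ) :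
    ∃ C, ∀ h ∈ Set.Ioc (0 : ℝ) 1, ∀ α : 𝓞 F, ∃ s,
      HasSum (fun γ : {γ : 𝓞 F // γ - α ∈ J} =>
        Ψ (h • mixedEmbedding F (algebraMap (𝓞 F) F γ))) s ∧
      |h ^ finrank ℚ F * s - (∫ x, Ψ x) / (Ideal.absNorm J * covolumeConst F)| ≤ C * h ^ k := by
  let I : (FractionalIdeal (𝓞 F)⁰ F)ˣ := Units.mk0 (J : FractionalIdeal (𝓞 F)⁰ F)
    (FractionalIdeal.coeIdeal_ne_zero.2 hJ)
  let b := fractionalIdealLatticeBasis F I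
  have hvol : volume.real (ZSpan.fundamentalDomain b) = Ideal.absNorm J * covolumeConst F := by
    rw [measureReal_def, volume_fundamentalDomain_fractionalIdealLatticeBasis, ENNReal.toReal_mul,
      Units.val_mk0, FractionalIdeal.coeIdeal_absNorm, ENNReal.toReal_ofReal (by positivity)]
    simp [covolumeConst, measureReal_def]
  obtain ⟨C, hC⟩ := LatticeSum.latticeSum_sub_integral_le volume b k hΨ hc
  refine ⟨C, fun h hh α => ?_⟩
  let c : mixedSpace F := mixedEmbedding F (algebraMap (𝓞 F) F α)
  have hmem : ∀ γ : {γ : 𝓞 F // γ - α ∈ J},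
      mixedEmbedding F (algebraMap (𝓞 F) F (γ - α)) ∈ Submodule.span ℤ (Set.range b) := fun γ =>
    (mem_span_fractionalIdealLatticeBasis F I).2
      ⟨_, (FractionalIdeal.mem_coeIdeal _).2 ⟨_, γ.2, rfl⟩, rfl⟩
  let e : {γ : 𝓞 F // γ - α ∈ J} ≃ Submodule.span ℤ (Set.range b) :=
    Equiv.ofBijective (fun γ => ⟨_, hmem γ⟩) (by
      constructor
      · intro γ γ' h
        simpa [sub_left_inj, Subtype.ext_iff, (mixedEmbedding_injective F).eq_iff] using h
      · rintro ⟨x, hx⟩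
        obtain ⟨y, hy, rfl⟩ := (mem_span_fractionalIdealLatticeBasis F I).1 hx
        obtain ⟨β, hβ, rfl⟩ := (FractionalIdeal.mem_coeIdeal _).1 hy
        exact ⟨⟨β + α, by simpa using hβ⟩, by simp⟩)
  have he : ∀ γ : {γ : 𝓞 F // γ - α ∈ J}, h • mixedEmbedding F (algebraMap (𝓞 F) F γ) = h • (c + (e γ : mixedSpace F)) :=
    fun γ => by
      have h1 : (e γ : mixedSpace F) = mixedEmbedding F (algebraMap (𝓞 F) F (γ - α)) := rfl
      rw [h1, ← map_add, ← map_add, add_sub_cancel]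
  obtain ⟨T, hT⟩ := LatticeSum.exists_finset_of_bounded b hc hh.1
    (Bornology.isBounded_singleton (x := c))
  refine ⟨∑' l : Submodule.span ℤ (Set.range b), Ψ (h • (c + l)), ?_, ?_⟩
  · simp only [he]
    exact (e.hasSum_iff (f := fun l : Submodule.span ℤ (Set.range b) => Ψ (h • (c + l)))).2
      (summable_of_ne_finset_zero (s := T) fun l hl => hT l hl c rfl).hasSum
  · have := hC h hh c
    rwa [hvol, LatticeSum.latticeSum, mixedEmbedding.finrank] at this

theorem ne_zero_of_testFun_ne_zero {W : ℝ → ℝ} {a b : ℝ} (ha : 0 < a)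
    (hW : ∀ x, W x ≠ 0 → x ∈ Set.Icc a b) {t : ℝ} {x : F}
    (h : testFun 𝔣 W (t • mixedEmbedding F x) ≠ 0) : x ≠ 0 := by
  rintro rfl
  rw [testFun] at h
  split_ifs at h with hp
  · have := (hW _ (left_ne_zero_of_mul h)).1
    rw [map_zero, smul_zero, map_zero] at this
    linarith
  · exact h rfl

theorem exists_mul_eq_one (g : RayClass 𝔣) (h𝔣 : 𝔣 ≠ ⊥) :
    ∃ b : coprimeIdeals 𝔣, g * (b : RayClass 𝔣) = 1 := by
  have hpos : 0 < Nat.card (ClassGroup (𝓞 F)) * rayExponent 𝔣 :=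
    Nat.mul_pos Nat.card_pos (rayExponent_pos h𝔣)
  obtain ⟨m, hm⟩ := Nat.exists_eq_succ_of_ne_zero hpos.ne'
  obtain ⟨b, hb⟩ := Con.mk'_surjective (c := rayCon 𝔣) (g ^ m)
  refine ⟨b, ?_⟩
  have hb' : (b : RayClass 𝔣) = g ^ m := hb
  have h1 := rayClass_pow_eq_one g
  generalize Nat.card (ClassGroup (𝓞 F)) * rayExponent 𝔣 = n at hm h1
  rw [hm, pow_succ'] at h1
  rw [hb', h1]

theorem rayClass_mul_eq_one_iff {I b : coprimeIdeals 𝔣} :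
    (I : RayClass 𝔣) * (b : RayClass 𝔣) = 1 ↔
      ∃ γ : 𝓞 F, γ ≠ 0 ∧ IsTotallyPositiveElem F (algebraMap (𝓞 F) F γ) ∧ γ - 1 ∈ 𝔣 ∧
        (I : Ideal (𝓞 F)) * b = Ideal.span {γ} := by
  have h : (I : RayClass 𝔣) * (b : RayClass 𝔣) = ((I * b : coprimeIdeals 𝔣) : RayClass 𝔣) := rfl
  rw [h, ← Submonoid.coe_mul, ← sameNarrowRayClass_one_iff]
  exact rayClass_eq_iff (a := I * b) (b := 1)

theorem hasSum_class (h𝔣 : 𝔣 ≠ ⊥) {W : ℝ → ℝ} {a' b' : ℝ} (ha : 0 < a')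
    (hW : ∀ x, W x ≠ 0 → x ∈ Set.Icc a' b') {g : RayClass 𝔣} {b : coprimeIdeals 𝔣}
    (hgb : g * (b : RayClass 𝔣) = 1) {α : 𝓞 F} (hαb : α ∈ (b : Ideal (𝓞 F))) (hα : α - 1 ∈ 𝔣)
    {h : ℝ} (hh : 0 < h) {s : ℝ}
    (hs : HasSum (fun γ : {γ : 𝓞 F // γ - α ∈ (b : Ideal (𝓞 F)) * 𝔣} =>
        testFun 𝔣 W (h • mixedEmbedding F (algebraMap (𝓞 F) F γ))) s) :
    HasSum (fun I : {I : coprimeIdeals 𝔣 // (I : RayClass 𝔣) = g} =>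
      Nat.card (rayUnits 𝔣 ⧸ (fundPow 𝔣).range) *
        W (h ^ finrank ℚ F * (Ideal.absNorm (I.1 : Ideal (𝓞 F)) * Ideal.absNorm (b : Ideal (𝓞 F)))))
      s := by
  have hgen : ∀ I : {I : coprimeIdeals 𝔣 // (I : RayClass 𝔣) = g}, (I.1 : RayClass 𝔣) * b = 1 :=
    fun I => by rw [I.2, hgb]
  choose γ hγ0 hγp hγ1 hγ using fun I => rayClass_mul_eq_one_iff.1 (hgen I)
  have hmem : ∀ β : 𝓞 F, β - α ∈ (b : Ideal (𝓞 F)) * 𝔣 ↔ β ∈ (b : Ideal (𝓞 F)) ∧ β - 1 ∈ 𝔣 := by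
    intro β
    rw [Ideal.mul_eq_inf_of_isCoprime b.2.2, Ideal.mem_inf, show β - α ∈ (b : Ideal (𝓞 F)) ↔ β ∈ (b : Ideal (𝓞 F)) from
        ⟨fun h => by simpa using Ideal.add_mem _ h hαb, fun h => Ideal.sub_mem _ h hαb⟩,
      ← Ideal.add_mem_iff_left (a := β - α) _ hα, sub_add_sub_cancel]
  have hγb : ∀ I, γ I ∈ (b : Ideal (𝓞 F)) := fun I =>
    Ideal.mul_le_right ((hγ I).symm ▸ Ideal.mem_span_singleton_self (γ I))
  let e : {I : coprimeIdeals 𝔣 // (I : RayClass 𝔣) = g} × rayUnits 𝔣 →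
      {γ : 𝓞 F // γ - α ∈ (b : Ideal (𝓞 F)) * 𝔣} := fun p =>
    ⟨(p.2 : (𝓞 F)ˣ) * γ p.1, (hmem _).2 ⟨Ideal.mul_mem_left _ _ (hγb _),
      mul_sub_one_mem p.2.2.2 (hγ1 _)⟩⟩
  have hb0 : (b : Ideal (𝓞 F)) ≠ 0 := b.2.1
  have hinj : Function.Injective e := by
    rintro ⟨I, u⟩ ⟨I', u'⟩ h
    have h1 : ((u : (𝓞 F)ˣ) : 𝓞 F) * γ I = ((u' : (𝓞 F)ˣ) : 𝓞 F) * γ I' := congrArg Subtype.val h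
    have h2 : I = I' := by
      have h3 : (I.1 : Ideal (𝓞 F)) * b = I'.1 * b := by
        rw [hγ, hγ, ← Ideal.span_singleton_mul_left_unit (u : (𝓞 F)ˣ).isUnit, h1,
          Ideal.span_singleton_mul_left_unit (u' : (𝓞 F)ˣ).isUnit]
      exact Subtype.ext (Subtype.ext (mul_right_cancel₀ hb0 h3))
    subst h2
    have h4 := mul_right_cancel₀ (hγ0 I) h1
    rw [Prod.mk.injEq]
    exact ⟨rfl, Subtype.ext (Units.ext h4)⟩
  have hrange : ∀ x ∉ Set.range e,
      testFun 𝔣 W (h • mixedEmbedding F (algebraMap (𝓞 F) F x)) = 0 := by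
    intro x hx
    by_contra hne
    apply hx
    have hp := isTotallyPositiveElem_of_testFun_ne_zero hh hne
    have h0 : (x : 𝓞 F) ≠ 0 := fun h0 => ne_zero_of_testFun_ne_zero ha hW hne (by simp [h0])
    obtain ⟨hxb, hx1⟩ := (hmem _).1 x.2
    obtain ⟨I, hI⟩ := Ideal.dvd_iff_le.2 ((Ideal.span_singleton_le_iff_mem _).2 hxb)
    replace hI := hI.trans (mul_comm _ _)
    have hspan : Ideal.span {(x : 𝓞 F)} ∈ coprimeIdeals 𝔣 :=
      ⟨by simpa using h0, Ideal.isCoprime_iff_exists.2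
        ⟨x, Ideal.mem_span_singleton_self _, 1 - x, by rw [← neg_sub]; exact 𝔣.neg_mem hx1,
          by ring⟩⟩
    have hIS := (mul_mem_coprimeIdeals_iff.1 (hI ▸ hspan)).1
    have hI1 : ((⟨I, hIS⟩ : coprimeIdeals 𝔣) : RayClass 𝔣) * b = 1 :=
      rayClass_mul_eq_one_iff.2 ⟨x, h0, hp, hx1, hI.symm⟩
    have hIg : ((⟨I, hIS⟩ : coprimeIdeals 𝔣) : RayClass 𝔣) = g := by
      rw [← mul_one ((⟨I, hIS⟩ : coprimeIdeals 𝔣) : RayClass 𝔣), ← hgb, mul_comm g, ← mul_assoc,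
        hI1, one_mul]
    have hsp := hγ ⟨⟨I, hIS⟩, hIg⟩
    set δ := γ ⟨⟨I, hIS⟩, hIg⟩ with hδ
    rw [← hI, Ideal.span_singleton_eq_span_singleton] at hsp
    obtain ⟨u, hu⟩ := hsp.symm
    have hδ1 : δ - 1 ∈ 𝔣 := hγ1 _
    have hδp := hγp ⟨⟨I, hIS⟩, hIg⟩
    have huray : u ∈ rayUnits 𝔣 := by
      refine mem_rayUnits.2 ⟨fun φ => ?_, ?_⟩
      · have := hp φ
        rw [← hu, map_mul, map_mul] at this
        exact pos_of_mul_pos_right this (hδp φ).le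
      · have h5 : (u : 𝓞 F) - 1 = (δ * u - 1) - (δ - 1) * u := by ring
        rw [h5, hu]
        exact 𝔣.sub_mem hx1 (𝔣.mul_mem_right _ hδ1)
    exact ⟨(⟨⟨I, hIS⟩, hIg⟩, ⟨u, huray⟩), Subtype.ext ((mul_comm _ _).trans hu)⟩
  refine ((hinj.hasSum_iff hrange).2 hs).prod_fiberwise fun I => ?_
  have := hasSum_testFun h𝔣 W (hγ0 I) (hγp I) hh
  rw [← hγ I, map_mul, Nat.cast_mul] at this
  exact this

theorem exists_hasSum_class_le (h𝔣 : 𝔣 ≠ ⊥) {W : ℝ → ℝ} {a b : ℝ} (ha : 0 < a)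
    (hW : ∀ x, W x ≠ 0 → x ∈ Set.Icc a b) (hWs : ContDiff ℝ ∞ W) (hW0 : ∀ x, 0 ≤ W x)
    {x₀ : ℝ} (hx₀ : W x₀ ≠ 0) :
    ∃ κ : ℝ, 0 < κ ∧ ∀ (g : RayClass 𝔣) (k : ℕ), ∃ C, ∀ t ∈ Set.Ioc (0 : ℝ) 1, ∃ s,
      HasSum (fun I : {I : coprimeIdeals 𝔣 // (I : RayClass 𝔣) = g} =>
        W (t * Ideal.absNorm (I.1 : Ideal (𝓞 F)))) s ∧ |s - κ / t| ≤ C * t ^ k := by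
  set m : ℝ := (Nat.card (rayUnits 𝔣 ⧸ (fundPow 𝔣).range) : ℝ)
  have hm : 0 < m := Nat.cast_pos.2 (card_rayUnits_quotient_pos h𝔣)
  set M := ∫ y : mixedSpace F, testFun 𝔣 W y
  have hM : 0 < M := integral_testFun_pos h𝔣 ha hW hWs hW0 hx₀
  have hN𝔣 : (0 : ℝ) < Ideal.absNorm 𝔣 := Nat.cast_pos.2 (Nat.pos_of_ne_zero
    (Ideal.absNorm_eq_zero_iff.not.2 h𝔣))
  refine ⟨M / (Ideal.absNorm 𝔣 * covolumeConst F) / m,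
    div_pos (div_pos hM (mul_pos hN𝔣 covolumeConst_pos)) hm, fun g k => ?_⟩
  obtain ⟨b, hgb⟩ := exists_mul_eq_one g h𝔣
  obtain ⟨α, hαb, β, hβ, hαβ⟩ := Ideal.isCoprime_iff_exists.1 b.2.2
  have hα : α - 1 ∈ 𝔣 := by
    rw [← hαβ, sub_add_cancel_left]
    exact 𝔣.neg_mem hβ
  set N : ℝ := (Ideal.absNorm (b : Ideal (𝓞 F)) : ℝ)
  have hN1 : 1 ≤ N := Nat.one_le_cast.2 (Nat.pos_of_ne_zero
    (Ideal.absNorm_eq_zero_iff.not.2 b.2.1))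
  have hN : 0 < N := one_pos.trans_le hN1
  obtain ⟨C, hC⟩ := exists_hasSum_coset_le (contDiff_testFun (F := F) h𝔣 ha hW hWs)
    (hasCompactSupport_testFun h𝔣 ha hW) (mul_ne_zero b.2.1 h𝔣 : (b : Ideal (𝓞 F)) * 𝔣 ≠ ⊥)
    (finrank ℚ F * (k + 1))
  refine ⟨C / m, fun t ht => ?_⟩
  set h := (t / N) ^ (finrank ℚ F : ℝ)⁻¹
  have htN : 0 < t / N := div_pos ht.1 hN
  have hhn : h ^ finrank ℚ F = t / N := Real.rpow_inv_natCast_pow htN.le finrank_pos.ne'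
  have hh : h ∈ Set.Ioc (0 : ℝ) 1 := ⟨Real.rpow_pos_of_pos htN _,
    Real.rpow_le_one htN.le ((div_le_one hN).2 (ht.2.trans hN1)) (by positivity)⟩
  obtain ⟨s, hs, hsC⟩ := hC h hh α
  have h1 := hasSum_class h𝔣 ha hW hgb hαb hα hh.1 hs
  have hC0 : 0 ≤ C := by
    have := (abs_nonneg _).trans hsC
    exact nonneg_of_mul_nonneg_left this (pow_pos hh.1 _)
  refine ⟨s / m, ?_, ?_⟩
  · convert! h1.div_const m using 2 with I
    rw [mul_div_cancel_left₀ _ hm.ne', hhn]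
    congr 1
    field_simp
    rfl
  · rw [pow_mul, hhn, map_mul, Nat.cast_mul] at hsC
    have h2 : s / m - M / (Ideal.absNorm 𝔣 * covolumeConst F) / m / t =
        (N / t / m) * (t / N * s - M / (N * Ideal.absNorm 𝔣 * covolumeConst F)) := by
      have := (covolumeConst_pos (F := F)).ne'
      have := ht.1.ne'
      field_simp
    rw [h2, abs_mul, abs_of_pos (div_pos (div_pos hN ht.1) hm)]
    calc N / t / m * |t / N * s - M / (N * Ideal.absNorm 𝔣 * covolumeConst F)|
        ≤ N / t / m * (C * (t / N) ^ (k + 1)) := by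
          gcongr
          exact div_nonneg (div_nonneg hN.le ht.1.le) hm.le
      _ = C / m * (t / N) ^ k := by
          have := ht.1.ne'
          rw [pow_succ]; field_simp
      _ ≤ C / m * t ^ k := by
          have := htN.le
          have := ht.1.le
          gcongr
          exact div_le_self ht.1.le hN1

end NarrowRay

namespace GenDirichlet

open Filter Topology Complex
open scoped ComplexOrder

variable {ι : Type*} {N : ι → ℕ} {w : ι → ℂ}

/-- The generalized Dirichlet series with coefficients `w` and norms `N`. -/
noncomputable def series (N : ι → ℕ) (w : ι → ℂ) (s : ℂ) : ℂ := ∑' i, w i * (N i : ℂ) ^ (-s)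

/-- Absolute convergence on the half plane `1 < re s`. -/
def Admissible (N : ι → ℕ) (w : ι → ℂ) : Prop :=
  ∀ σ : ℝ, 1 < σ → Summable fun i => ‖w i‖ * (N i : ℝ) ^ (-σ)

theorem norm_term (hN : ∀ i, 0 < N i) (w : ι → ℂ) (i : ι) (s : ℂ) :
    ‖w i * (N i : ℂ) ^ (-s)‖ = ‖w i‖ * (N i : ℝ) ^ (-s.re) := by
  rw [norm_mul, norm_natCast_cpow_of_pos (hN i), neg_re]

theorem Admissible.summable (h : Admissible N w) (hN : ∀ i, 0 < N i) {s : ℂ} (hs : 1 < s.re) :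
    Summable fun i => w i * (N i : ℂ) ^ (-s) :=
  .of_norm ((h s.re hs).congr fun i => (norm_term hN w i s).symm)

theorem Admissible.mono {v : ι → ℂ} (h : Admissible N w) (hv : ∀ i, ‖v i‖ ≤ ‖w i‖) :
    Admissible N v := fun σ hσ =>
  (h σ hσ).of_nonneg_of_le (fun i => by positivity) fun i => by gcongr; exact hv i

theorem Admissible.mul_log (h : Admissible N w) (hN : ∀ i, 0 < N i) :
    Admissible N fun i => w i * Real.log (N i) := by
  intro σ hσ
  have hε : 0 < (σ - 1) / 2 := by linarith
  refine ((h ((σ + 1) / 2) (by linarith)).mul_left (((σ - 1) / 2)⁻¹)).of_nonneg_of_le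
    (fun i => by positivity) fun i => ?_
  have hNi : (1 : ℝ) ≤ N i := by exact_mod_cast hN i
  have hl := Real.log_le_rpow_div (x := (N i : ℝ)) (by positivity) hε
  have : (N i : ℝ) ^ (-((σ + 1) / 2)) = (N i : ℝ) ^ ((σ - 1) / 2) * (N i : ℝ) ^ (-σ) := by
    rw [← Real.rpow_add (by linarith)]; congr 1; ring
  rw [norm_mul, Complex.norm_real, Real.norm_of_nonneg (Real.log_nonneg hNi), this]
  calc ‖w i‖ * Real.log (N i) * (N i : ℝ) ^ (-σ)
      ≤ ‖w i‖ * ((N i : ℝ) ^ ((σ - 1) / 2) / ((σ - 1) / 2)) * (N i : ℝ) ^ (-σ) := by gcongr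
    _ = _ := by ring

theorem hasDerivAt_series (h : Admissible N w) (hN : ∀ i, 0 < N i) {s : ℂ} (hs : 1 < s.re) :
    HasDerivAt (series N w) (-series N (fun i => w i * Real.log (N i)) s) s := by
  obtain ⟨σ, hσ1, hσ2⟩ := exists_between hs
  let U : Set ℂ := {z | σ < z.re}
  have hU : IsOpen U := isOpen_lt continuous_const continuous_re
  have hd (i : ι) (z : ℂ) : HasDerivAt (fun z => w i * (N i : ℂ) ^ (-z))
      (-(w i * Real.log (N i) * (N i : ℂ) ^ (-z))) z := by
    have := ((hasDerivAt_neg z).const_cpow (c := (N i : ℂ))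
      (Or.inl (by exact_mod_cast (hN i).ne'))).const_mul (w i)
    refine this.congr_deriv ?_
    rw [← natCast_log]; ring
  have hb (i : ι) (z : ℂ) (hz : z ∈ U) : ‖w i * (N i : ℂ) ^ (-z)‖ ≤ ‖w i‖ * (N i : ℝ) ^ (-σ) := by
    rw [norm_term hN]
    have : (1 : ℝ) ≤ N i := by exact_mod_cast hN i
    have hz' : σ < z.re := hz
    gcongr
  have hdiff (i : ι) : DifferentiableOn ℂ (fun z => w i * (N i : ℂ) ^ (-z)) U :=
    fun z _ => (hd i z).differentiableAt.differentiableWithinAt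
  have h1 := hasSum_deriv_of_summable_norm (h σ hσ1) hdiff hU hb (z := s) hσ2
  have h2 := differentiableOn_tsum_of_summable_norm (h σ hσ1) hdiff hU hb
  have h3 := (h2.differentiableAt (hU.mem_nhds hσ2)).hasDerivAt
  refine h3.congr_deriv ?_
  rw [← h1.tsum_eq, series, ← tsum_neg]
  exact tsum_congr fun i => (hd i s).deriv

theorem isOpen_one_lt_re : IsOpen {s : ℂ | 1 < s.re} := isOpen_lt continuous_const continuous_re

theorem analyticAt_series (h : Admissible N w) (hN : ∀ i, 0 < N i) {s : ℂ} (hs : 1 < s.re) :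
    AnalyticAt ℂ (series N w) s := by
  refine DifferentiableOn.analyticAt (s := {s : ℂ | 1 < s.re}) (fun z hz => ?_)
    (isOpen_one_lt_re.mem_nhds hs)
  exact (hasDerivAt_series h hN hz).differentiableAt.differentiableWithinAt

theorem series_ofReal_nonneg (hw : ∀ i, 0 ≤ w i) (σ : ℝ) : 0 ≤ series N w σ := by
  refine tsum_nonneg fun i => mul_nonneg (hw i) ?_
  rw [← ofReal_neg, ← ofReal_natCast, ← ofReal_cpow (by positivity)]
  exact_mod_cast (by positivity : (0 : ℝ) ≤ (N i : ℝ) ^ (-σ))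

theorem alternating_series (hN : ∀ i, 0 < N i) (n : ℕ) {w : ι → ℂ} (h : Admissible N w)
    (hw : ∀ i, 0 ≤ w i) {σ : ℝ} (hσ : 1 < σ) :
    0 ≤ (-1) ^ n * iteratedDeriv n (series N w) σ := by
  induction n generalizing w with
  | zero => simpa using series_ofReal_nonneg hw σ
  | succ n ih =>
    have h1 := ih (h.mul_log hN) fun i => mul_nonneg (hw i) (by
      have : (1 : ℝ) ≤ N i := by exact_mod_cast hN i
      exact_mod_cast Real.log_nonneg this)
    have h2 : deriv (series N w) =ᶠ[𝓝 (σ : ℂ)]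
        fun s => -series N (fun i => w i * Real.log (N i)) s := by
      filter_upwards [isOpen_one_lt_re.mem_nhds (show (σ : ℂ) ∈ {s : ℂ | 1 < s.re} by simpa)]
        with z hz using (hasDerivAt_series h hN hz).deriv
    rw [iteratedDeriv_succ', h2.iteratedDeriv_eq, iteratedDeriv_fun_neg, pow_succ]
    simpa using h1

theorem alternating_of_deriv_eq {Y E : ℂ → ℂ} {c : ℂ} (hY : AnalyticAt ℂ Y c)
    (hE : AnalyticAt ℂ E c) (h : deriv Y =ᶠ[𝓝 c] fun s => -(E s * Y s))
    (hE0 : ∀ n, 0 ≤ (-1) ^ n * iteratedDeriv n E c) (hY0 : 0 ≤ Y c) (n : ℕ) :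
    0 ≤ (-1) ^ n * iteratedDeriv n Y c := by
  induction n using Nat.strong_induction_on with
  | _ n ih =>
    cases n with
    | zero => simpa using hY0
    | succ n =>
      rw [iteratedDeriv_succ', h.iteratedDeriv_eq, iteratedDeriv_fun_neg, pow_succ,
        iteratedDeriv_fun_mul hE.contDiffAt hY.contDiffAt, mul_assoc, neg_mul_neg, one_mul,
        Finset.mul_sum]
      refine Finset.sum_nonneg fun i hi => ?_
      have hi' : i ≤ n := Nat.lt_succ_iff.1 (Finset.mem_range.1 hi)
      have h1 := mul_nonneg (hE0 i) (ih (n - i) (by omega))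
      have h2 := mul_nonneg (Nat.cast_nonneg (α := ℂ) (n.choose i)) h1
      have e : (-1 : ℂ) ^ n = (-1) ^ i * (-1) ^ (n - i) := by rw [← pow_add, Nat.add_sub_cancel' hi']
      rw [e]
      exact h2.trans_eq (by ring)

theorem apply_le_of_alternating_ball {f : ℂ → ℂ} {c r : ℝ}
    (hf : DifferentiableOn ℂ f (Metric.ball (c : ℂ) r))
    (h : ∀ n, 0 ≤ (-1) ^ n * iteratedDeriv n f c) {x : ℝ} (hx : x ≤ c) (hxr : c - r < x) :
    f c ≤ f x := by
  have hr : 0 < r := by linarith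
  have hd : DifferentiableOn ℂ (fun z => f (-z) - f c) (Metric.ball ((-c : ℝ) : ℂ) r) := by
    refine DifferentiableOn.sub_const (hf.comp (differentiable_neg.differentiableOn) ?_) _
    intro z hz
    rw [Metric.mem_ball, dist_eq] at hz ⊢
    rwa [← norm_neg, neg_sub, sub_neg_eq_add, add_comm, ← sub_neg_eq_add, ← ofReal_neg]
  have key := hd.nonneg_of_iteratedDeriv_nonneg (fun n => ?_) (z := ((-x : ℝ) : ℂ))
    (by exact_mod_cast neg_le_neg hx) ?_
  · simpa using key
  · cases n with
    | zero => simp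
    | succ n =>
      have : iteratedDeriv (n + 1) (fun z => f (-z) - f c) =
          iteratedDeriv (n + 1) (fun z => f (-z)) := by
        rw [iteratedDeriv_succ', iteratedDeriv_succ']
        congr 1; ext z; exact deriv_sub_const ..
      rw [this, iteratedDeriv_comp_neg]
      simpa using h (n + 1)
  · rw [Metric.mem_ball, dist_eq, ← ofReal_sub, norm_real, Real.norm_eq_abs, abs_lt]
    constructor <;> linarith

end GenDirichlet

/-- A commutative monoid with unique factorization into primes, a norm, a class map to a finite
abelian group, and a smoothed equidistribution of its elements among the classes. -/
structure NormedMonoid (S P G : Type*) [CommMonoid S] [CommGroup G] where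
  /-- The norm. -/
  norm : S →* ℕ
  /-- The class map. -/
  cls : S →* G
  /-- The primes. -/
  prime : P → S
  mul_right_injective : ∀ a : S, Function.Injective fun b : S => a * b
  norm_pos : ∀ I, 0 < norm I
  eq_one_of_norm : ∀ I, norm I = 1 → I = 1
  two_le_norm_prime : ∀ p, 2 ≤ norm (prime p)
  summable_norm : ∀ σ : ℝ, 1 < σ → Summable fun I => (norm I : ℝ) ^ (-σ)
  hasSum_log : ∀ I, HasSum (fun x : P × ℕ =>
    Set.indicator {x : P × ℕ | prime x.1 ^ (x.2 + 1) ∣ I}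
      (fun x => Real.log (norm (prime x.1))) x) (Real.log (norm I))
  smooth_count : ∀ (W : ℝ → ℝ) (a b x₀ : ℝ), 0 < a → (∀ x, W x ≠ 0 → x ∈ Set.Icc a b) →
    ContDiff ℝ (⊤ : ℕ∞) W → (∀ x, 0 ≤ W x) → W x₀ ≠ 0 →
    ∃ κ : ℝ, 0 < κ ∧ ∀ (g : G) (k : ℕ), ∃ C, ∀ t ∈ Set.Ioc (0 : ℝ) 1, ∃ s,
      HasSum (fun I : {I // cls I = g} => W (t * norm I.1)) s ∧ |s - κ / t| ≤ C * t ^ k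

namespace NormedMonoid

open Filter Topology GenDirichlet
open scoped ComplexOrder

variable {S P G : Type*} [CommMonoid S] [CommGroup G] [Finite G] (M : NormedMonoid S P G)

/-- The norm of a prime power. -/
def primePowNorm (x : P × ℕ) : ℕ := M.norm (M.prime x.1) ^ (x.2 + 1)

/-- The coefficients of the logarithmic derivative of an `L`-function. -/
noncomputable def logCoeff (χ : G →* ℂˣ) (x : P × ℕ) : ℂ :=
  Real.log (M.norm (M.prime x.1)) * χ (M.cls (M.prime x.1)) ^ (x.2 + 1)

/-- The `L`-function of a character. -/
noncomputable def L (χ : G →* ℂˣ) : ℂ → ℂ := series M.norm fun I => χ (M.cls I)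

/-- The negative logarithmic derivative of the `L`-function of a character. -/
noncomputable def logSeries (χ : G →* ℂˣ) : ℂ → ℂ := series M.primePowNorm (M.logCoeff χ)

theorem norm_char (χ : G →* ℂˣ) (g : G) : ‖(χ g : ℂ)‖ = 1 := by
  have : Nat.card G ≠ 0 := Nat.card_pos.ne'
  refine Complex.norm_eq_one_of_pow_eq_one (n := Nat.card G) ?_ this
  rw [← Units.val_pow_eq_pow_val, ← map_pow, pow_card_eq_one', map_one, Units.val_one]

theorem primePowNorm_pos (x : P × ℕ) : 0 < M.primePowNorm x := pow_pos (M.norm_pos _) _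

theorem admissible_L (χ : G →* ℂˣ) : Admissible M.norm fun I => (χ (M.cls I) : ℂ) := fun σ hσ => by
  simpa [norm_char] using M.summable_norm σ hσ

theorem one_le_norm_prime (p : P) : (1 : ℝ) ≤ M.norm (M.prime p) := by
  exact_mod_cast M.norm_pos _

theorem log_norm_prime_nonneg (p : P) : 0 ≤ Real.log (M.norm (M.prime p)) :=
  Real.log_nonneg (M.one_le_norm_prime p)

/-- The summands of the double series for `L' = - L * logSeries`. -/
noncomputable def pairTerm (f : S → ℂ) (y : S × (P × ℕ)) : ℂ :=
  f y.1 * Set.indicator {x : P × ℕ | M.prime x.1 ^ (x.2 + 1) ∣ y.1}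
      (fun x => Real.log (M.norm (M.prime x.1))) y.2

variable {M} {f : S →* ℂ}

theorem summable_pairTerm (hf : Summable fun I => ‖f I‖ * Real.log (M.norm I)) :
    Summable (M.pairTerm f) := by
  refine .of_norm ?_
  have hn (I : S) (x : P × ℕ) : ‖M.pairTerm f (I, x)‖ = ‖f I‖ *
      Set.indicator {x : P × ℕ | M.prime x.1 ^ (x.2 + 1) ∣ I}
        (fun x => Real.log (M.norm (M.prime x.1))) x := by
    rw [pairTerm, norm_mul, Complex.norm_real, Real.norm_of_nonneg]
    exact Set.indicator_nonneg (fun x _ => M.log_norm_prime_nonneg _) _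
  refine (summable_prod_of_nonneg fun _ => norm_nonneg _).2 ⟨fun I => ?_, ?_⟩
  · simp only [hn]
    exact ((M.hasSum_log I).mul_left _).summable
  · simp only [hn]
    refine hf.congr fun I => ?_
    rw [((M.hasSum_log I).mul_left _).tsum_eq]

theorem hasSum_pairTerm_row (hf : Summable f) (x : P × ℕ) :
    HasSum (fun I => M.pairTerm f (I, x))
      (Real.log (M.norm (M.prime x.1)) * f (M.prime x.1) ^ (x.2 + 1) * ∑' I, f I) := by
  have hinj := M.mul_right_injective (M.prime x.1 ^ (x.2 + 1))
  rw [← hinj.hasSum_iff]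
  · convert! hf.hasSum.mul_left (Real.log (M.norm (M.prime x.1)) * f (M.prime x.1) ^ (x.2 + 1))
      using 2 with J
    simp only [Function.comp, pairTerm]
    rw [Set.indicator_of_mem (by exact Dvd.intro _ rfl), map_mul, map_pow]
    ring
  · intro I hI
    rw [pairTerm, Set.indicator_of_notMem, Complex.ofReal_zero, mul_zero]
    rintro ⟨J, hJ⟩
    exact hI ⟨J, hJ.symm⟩

theorem summable_log_mul_pow (hf : Summable fun I => ‖f I‖ * Real.log (M.norm I)) :
    Summable fun x : P × ℕ => Real.log (M.norm (M.prime x.1)) * f (M.prime x.1) ^ (x.2 + 1) := by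
  have hinj : Function.Injective fun x : P × ℕ => (M.prime x.1 ^ (x.2 + 1), x) :=
    fun x y h => (Prod.ext_iff.1 h).2
  refine ((summable_pairTerm hf).comp_injective hinj).congr fun x => ?_
  simp only [Function.comp, pairTerm]
  rw [Set.indicator_of_mem (by exact dvd_rfl), map_pow, mul_comm]

theorem tsum_log_mul_tsum (hf : Summable f)
    (hf' : Summable fun I => ‖f I‖ * Real.log (M.norm I)) :
    (∑' x : P × ℕ, Real.log (M.norm (M.prime x.1)) * f (M.prime x.1) ^ (x.2 + 1)) * ∑' I, f I =
      ∑' I, f I * Real.log (M.norm I) := by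
  have h := summable_pairTerm hf'
  rw [← tsum_mul_right]
  have h1 := h.prod_symm.hasSum.prod_fiberwise fun x => hasSum_pairTerm_row hf x
  have h2 := h.hasSum.prod_fiberwise (g := fun I => f I * Real.log (M.norm I)) fun I =>
    ((Complex.hasSum_ofReal.2 (M.hasSum_log I)).mul_left (f I))
  rw [h1.tsum_eq, h2.tsum_eq]
  exact (Equiv.prodComm (P × ℕ) S).tsum_eq (M.pairTerm f)

variable (M)

/-- The multiplicative function `I ↦ χ I * N I ^ (-s)`. -/
noncomputable def twist (χ : G →* ℂˣ) (s : ℂ) : S →* ℂ where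
  toFun I := χ (M.cls I) * (M.norm I : ℂ) ^ (-s)
  map_one' := by simp
  map_mul' a b := by
    rw [map_mul, map_mul, Units.val_mul, map_mul, Nat.cast_mul, Complex.natCast_mul_natCast_cpow]
    ring

theorem norm_twist (χ : G →* ℂˣ) (s : ℂ) (I : S) :
    ‖M.twist χ s I‖ = (M.norm I : ℝ) ^ (-s.re) := by
  have := norm_term M.norm_pos (fun I => (χ (M.cls I) : ℂ)) I s
  rw [norm_char, one_mul] at this
  exact this

theorem summable_norm_twist_mul_log (χ : G →* ℂˣ) {s : ℂ} (hs : 1 < s.re) :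
    Summable fun I => ‖M.twist χ s I‖ * Real.log (M.norm I) := by
  refine (((M.admissible_L χ).mul_log M.norm_pos) s.re hs).congr fun I => ?_
  rw [norm_mul, norm_char, norm_twist, Complex.norm_real, Real.norm_of_nonneg, one_mul, mul_comm]
  exact Real.log_nonneg (by exact_mod_cast M.norm_pos I)

theorem natCast_pow_cpow (a k : ℕ) (s : ℂ) : ((a ^ k : ℕ) : ℂ) ^ s = ((a : ℂ) ^ s) ^ k := by
  induction k with
  | zero => simp
  | succ k ih => rw [pow_succ, pow_succ, Nat.cast_mul, Complex.natCast_mul_natCast_cpow, ih]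

theorem log_mul_twist_pow (χ : G →* ℂˣ) (s : ℂ) (x : P × ℕ) :
    Real.log (M.norm (M.prime x.1)) * M.twist χ s (M.prime x.1) ^ (x.2 + 1) =
      M.logCoeff χ x * (M.primePowNorm x : ℂ) ^ (-s) := by
  rw [logCoeff, primePowNorm, natCast_pow_cpow]
  simp only [twist, MonoidHom.coe_mk, OneHom.coe_mk]
  ring

theorem admissible_logCoeff (χ : G →* ℂˣ) : Admissible M.primePowNorm (M.logCoeff χ) := by
  intro σ hσ
  have := summable_log_mul_pow (M.summable_norm_twist_mul_log χ (s := σ) (by simpa))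
  refine this.norm.congr fun x => ?_
  rw [log_mul_twist_pow, norm_term M.primePowNorm_pos, Complex.ofReal_re]

theorem hasDerivAt_L (χ : G →* ℂˣ) {s : ℂ} (hs : 1 < s.re) :
    HasDerivAt (M.L χ) (-(M.logSeries χ s * M.L χ s)) s := by
  refine (hasDerivAt_series (M.admissible_L χ) M.norm_pos hs).congr_deriv ?_
  have hf : Summable (M.twist χ s) := by
    refine .of_norm (((M.admissible_L χ) s.re hs).congr fun I => ?_)
    rw [norm_twist, norm_char, one_mul]
  have := tsum_log_mul_tsum hf (M.summable_norm_twist_mul_log χ hs)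
  simp only [log_mul_twist_pow] at this
  rw [logSeries, L, show series M.norm (fun I => (χ (M.cls I) : ℂ)) s = ∑' I, M.twist χ s I from rfl,
    series, series, this]
  congr 1
  refine tsum_congr fun I => ?_
  simp only [twist, MonoidHom.coe_mk, OneHom.coe_mk]
  ring

end NormedMonoid

namespace MellinBump

open Filter Topology MeasureTheory Set

theorem isBigO_rpow_zero_of_eventually_eq {l : Filter ℝ} {f : ℝ → ℂ} (h : ∀ᶠ t in l, f t = 0)
    (a : ℝ) : f =O[l] fun t => t ^ a :=
  (Asymptotics.isBigO_zero _ l).congr' (h.mono fun _ ht => ht.symm) .rfl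

theorem eventually_nhdsGT_zero {f : ℝ → ℂ} {a : ℝ} (ha : 0 < a)
    (h : ∀ t ∈ Ioo 0 a, f t = 0) : ∀ᶠ t in 𝓝[>] 0, f t = 0 := by
  filter_upwards [Ioo_mem_nhdsGT ha] using h

theorem eventually_atTop_zero {f : ℝ → ℂ} {b : ℝ}
    (h : ∀ t, b < t → f t = 0) : ∀ᶠ t in atTop, f t = 0 := by
  filter_upwards [eventually_gt_atTop b] using h

variable {W : ℝ → ℝ} {a b : ℝ}

theorem isBigO_atTop (hW : ∀ x, W x ≠ 0 → x ∈ Icc a b) (c : ℝ) :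
    (fun t => (W t : ℂ)) =O[atTop] fun t => t ^ c :=
  isBigO_rpow_zero_of_eventually_eq (eventually_atTop_zero (b := b) fun t ht => by
    by_contra h
    exact absurd (hW t (by simpa using h)).2 (not_le.2 ht)) c

theorem isBigO_nhdsGT_zero (ha : 0 < a) (hW : ∀ x, W x ≠ 0 → x ∈ Icc a b) (c : ℝ) :
    (fun t => (W t : ℂ)) =O[𝓝[>] 0] fun t => t ^ c :=
  isBigO_rpow_zero_of_eventually_eq (eventually_nhdsGT_zero ha fun t ht => by
    by_contra h
    exact absurd (hW t (by simpa using h)).1 (not_le.2 ht.2)) c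

theorem locallyIntegrableOn_bump (hWc : Continuous W) :
    LocallyIntegrableOn (fun t => (W t : ℂ)) (Ioi 0) :=
  (Complex.continuous_ofReal.comp hWc).continuousOn.locallyIntegrableOn measurableSet_Ioi

theorem mellinConvergent_bump (ha : 0 < a) (hW : ∀ x, W x ≠ 0 → x ∈ Icc a b)
    (hWc : Continuous W) (s : ℂ) : MellinConvergent (fun t => (W t : ℂ)) s := by
  refine mellinConvergent_of_isBigO_rpow (a := s.re + 1) (b := s.re - 1)
    (locallyIntegrableOn_bump hWc) (isBigO_atTop hW _) (by linarith)
    (isBigO_nhdsGT_zero ha hW _) (by linarith)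

theorem differentiable_mellin_bump (ha : 0 < a) (hW : ∀ x, W x ≠ 0 → x ∈ Icc a b)
    (hWc : Continuous W) : Differentiable ℂ (mellin fun t => (W t : ℂ)) := fun s => by
  refine mellin_differentiableAt_of_isBigO_rpow (a := s.re + 1) (b := s.re - 1)
    (locallyIntegrableOn_bump hWc) (isBigO_atTop hW _) (by linarith)
    (isBigO_nhdsGT_zero ha hW _) (by linarith)

theorem re_cpow_of_pos {t : ℝ} (ht : 0 < t) (z : ℂ) :
    ((t : ℂ) ^ z).re = Real.exp (Real.log t * z.re) * Real.cos (Real.log t * z.im) := by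
  rw [Complex.cpow_def_of_ne_zero (by exact_mod_cast ht.ne'), ← Complex.ofReal_log ht.le,
    Complex.exp_re, Complex.re_ofReal_mul, Complex.im_ofReal_mul]

/-- A bump function supported just below `1`, whose Mellin transform has positive real part on a
given horizontal strip. -/
theorem exists_bump {T : ℝ} (hT : 0 < T) : ∃ (W : ℝ → ℝ) (a x₀ : ℝ), 0 < a ∧
    (∀ x, W x ≠ 0 → x ∈ Icc a 1) ∧ ContDiff ℝ (⊤ : ℕ∞) W ∧ (∀ x, 0 ≤ W x) ∧ W x₀ ≠ 0 ∧
    ∀ s : ℂ, |s.im| ≤ T → 0 < (mellin (fun t => (W t : ℂ)) s).re := by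
  have hexp : Real.exp (-T⁻¹) < 1 := by simpa using hT
  set a := Real.exp (-T⁻¹) with ha
  have ha0 : 0 < a := Real.exp_pos _
  let W : ContDiffBump ((a + 1) / 2) := ⟨(1 - a) / 4, (1 - a) / 2, by linarith, by linarith⟩
  have hsupp : Function.support (W : ℝ → ℝ) = Ioo a 1 := by
    rw [W.support_eq, Real.ball_eq_Ioo]
    congr 1 <;> · simp only [W]; ring
  have hW (x : ℝ) (hx : W x ≠ 0) : x ∈ Icc a 1 := by
    have : x ∈ Function.support (W : ℝ → ℝ) := hx
    rw [hsupp] at this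
    exact Ioo_subset_Icc_self this
  refine ⟨W, a, (a + 1) / 2, ha0, hW, W.contDiff, fun _ => W.nonneg, ?_, fun s hs => ?_⟩
  · rw [← Function.mem_support, hsupp]
    constructor <;> linarith
  have hconv := mellinConvergent_bump ha0 hW W.continuous s
  have hre : (mellin (fun t => (W t : ℂ)) s).re =
      ∫ t in Ioi (0 : ℝ), ((t : ℂ) ^ (s - 1) • (W t : ℂ)).re := (integral_re hconv).symm
  have hcos (t : ℝ) (ht : t ∈ Icc a 1) : 0 < ((t : ℂ) ^ (s - 1)).re := by
    have ht0 := ha0.trans_le ht.1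
    rw [re_cpow_of_pos ht0]
    refine mul_pos (Real.exp_pos _) (Real.cos_pos_of_mem_Ioo (abs_lt.1 ?_))
    have h1 : |Real.log t| ≤ T⁻¹ := by
      rw [abs_of_nonpos (Real.log_nonpos ht0.le ht.2), neg_le]
      have := Real.log_le_log ha0 ht.1
      rwa [ha, Real.log_exp] at this
    rw [abs_mul]
    calc |Real.log t| * |(s - 1).im| ≤ T⁻¹ * T := by
          gcongr
          simpa using hs
      _ = 1 := inv_mul_cancel₀ hT.ne'
      _ < Real.pi / 2 := by linarith [Real.pi_gt_three]
  have hval (t : ℝ) : ((t : ℂ) ^ (s - 1) • (W t : ℂ)).re = ((t : ℂ) ^ (s - 1)).re * W t := by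
    rw [smul_eq_mul, Complex.re_mul_ofReal]
  rw [hre, setIntegral_pos_iff_support_of_nonneg_ae]
  · have hsub : Ioo a 1 ⊆ Function.support (fun t : ℝ => ((t : ℂ) ^ (s - 1) • (W t : ℂ)).re) ∩
        Ioi 0 := fun t ht => by
      refine ⟨?_, ha0.trans ht.1⟩
      rw [Function.mem_support, hval]
      rw [← hsupp] at ht
      exact mul_ne_zero (hcos t (hW t ht)).ne' ht
    refine lt_of_lt_of_le ?_ (measure_mono hsub)
    simpa using hexp
  · refine Eventually.of_forall fun t => ?_
    simp only [Pi.zero_apply, hval]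
    by_cases h : W t = 0
    · simp [h]
    · exact mul_nonneg (hcos t (hW t h)).le W.nonneg
  · exact hconv.re

end MellinBump

namespace NormedMonoid

open Filter Topology GenDirichlet MeasureTheory Set MellinBump

variable {S P G : Type*} [CommMonoid S] [CommGroup G] [Finite G] (M : NormedMonoid S P G)

theorem finite_norm_le (x : ℝ) : {I : S | (M.norm I : ℝ) ≤ x}.Finite := by
  have h := (M.summable_norm 2 (by norm_num)).tendsto_cofinite_zero
  rcases le_or_gt x 0 with hx | hx
  · convert finite_empty
    ext I
    have : (0 : ℝ) < M.norm I := by exact_mod_cast M.norm_pos I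
    simp only [mem_ofPred_eq, mem_empty_iff_false, iff_false]
    linarith
  have h2 : ∀ᶠ I in cofinite, (M.norm I : ℝ) ^ (-2 : ℝ) < x ^ (-2 : ℝ) :=
    h.eventually (gt_mem_nhds (by positivity))
  refine (Filter.eventually_cofinite.1 h2).subset fun I hI => ?_
  rw [mem_ofPred_eq, not_lt]
  have : (0 : ℝ) < M.norm I := by exact_mod_cast M.norm_pos I
  exact Real.rpow_le_rpow_of_nonpos this hI (by norm_num)

theorem countable_carrier (M : NormedMonoid S P G) : Countable S := by
  have h := (M.summable_norm 2 (by norm_num)).countable_support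
  refine Set.countable_univ_iff.1 (h.mono fun I _ => ?_)
  have : (0 : ℝ) < M.norm I := by exact_mod_cast M.norm_pos I
  exact (by positivity : (M.norm I : ℝ) ^ (-2 : ℝ) ≠ 0)

/-- The partial zeta function of a class. -/
noncomputable def classZeta (g : G) : ℂ → ℂ :=
  series (fun I : {I // M.cls I = g} => M.norm I.1) fun _ => 1

/-- The smoothed counting function of a class. -/
noncomputable def classCount (W : ℝ → ℝ) (g : G) (t : ℝ) : ℂ :=
  ∑' I : {I // M.cls I = g}, (W (t * M.norm I.1) : ℂ)

variable {W : ℝ → ℝ} {a b : ℝ} (g : G)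

theorem one_le_norm (I : S) : (1 : ℝ) ≤ M.norm I := by exact_mod_cast M.norm_pos I

theorem continuousOn_classCount (hW : ∀ x, W x ≠ 0 → x ∈ Icc a 1) (hWc : Continuous W) :
    ContinuousOn (M.classCount W g) (Ioi 0) := by
  refine continuousOn_of_forall_continuousAt fun t (ht : 0 < t) => ?_
  have hfin : {I : {I // M.cls I = g} | (M.norm I.1 : ℝ) ≤ 2 / t}.Finite :=
    (M.finite_norm_le (2 / t)).preimage Subtype.val_injective.injOn
  have heq : M.classCount W g =ᶠ[𝓝 t] fun u => ∑ I ∈ hfin.toFinset, (W (u * M.norm I.1) : ℂ) := by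
    filter_upwards [Ioi_mem_nhds (half_lt_self ht)] with u hu
    refine tsum_eq_sum fun I hI => ?_
    by_contra h
    refine hI ?_
    rw [Set.Finite.mem_toFinset, mem_ofPred_eq, le_div_iff₀ ht]
    have h1 := (hW _ (by simpa using h)).2
    have h2 : t / 2 < u := hu
    nlinarith [M.one_le_norm I.1]
  refine ContinuousAt.congr ?_ heq.symm
  exact (continuous_finsetSum _ fun I _ => Complex.continuous_ofReal.comp
    (hWc.comp (continuous_mul_const _))).continuousAt

theorem hasMellin_classCount (ha : 0 < a) (hW : ∀ x, W x ≠ 0 → x ∈ Icc a 1) (hW0 : ∀ x, 0 ≤ W x)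
    (hWc : Continuous W) {s : ℂ} (hs : 1 < s.re) :
    mellin (M.classCount W g) s = M.classZeta g s * mellin (fun t => (W t : ℂ)) s := by
  have := M.countable_carrier
  have hN (I : S) : (0 : ℝ) < M.norm I := by exact_mod_cast M.norm_pos I
  have hconv (I : S) (s : ℂ) : MellinConvergent (fun t => (W (t * M.norm I) : ℂ)) s := by
    simp only [mul_comm _ (M.norm I : ℝ)]
    exact (MellinConvergent.comp_mul_left (f := fun t => (W t : ℂ)) (hN I)).2
      (mellinConvergent_bump ha hW hWc s)
  have hmel (I : S) (s : ℂ) : mellin (fun t => (W (t * M.norm I) : ℂ)) s =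
      (M.norm I : ℂ) ^ (-s) * mellin (fun t => (W t : ℂ)) s := by
    simp only [mul_comm _ (M.norm I : ℝ)]
    have := mellin_comp_mul_left (fun t => (W t : ℂ)) s (hN I)
    simpa using this
  have hnorm (I : S) : ∫ t in Ioi (0 : ℝ), ‖(t : ℂ) ^ (s - 1) • (W (t * M.norm I) : ℂ)‖ =
      (M.norm I : ℝ) ^ (-s.re) * (mellin (fun t => (W t : ℂ)) s.re).re := by
    have h1 := congrArg Complex.re (hmel I s.re)
    rw [← Complex.ofReal_natCast, ← Complex.ofReal_neg, ← Complex.ofReal_cpow (hN I).le,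
      Complex.re_ofReal_mul] at h1
    rw [← h1, mellin]
    refine Eq.trans ?_ (integral_re (hconv I s.re))
    refine setIntegral_congr_fun measurableSet_Ioi fun t (ht : 0 < t) => ?_
    simp only
    rw [norm_smul, Complex.norm_cpow_eq_rpow_re_of_pos ht, Complex.norm_real,
      Real.norm_of_nonneg (hW0 _), ← Complex.ofReal_one, ← Complex.ofReal_sub,
      ← Complex.ofReal_cpow ht.le, smul_eq_mul, ← Complex.ofReal_mul]
    simp
  have key := hasSum_integral_of_summable_integral_norm (μ := volume.restrict (Ioi (0 : ℝ)))
    (F := fun (I : {I // M.cls I = g}) t => (t : ℂ) ^ (s - 1) • (W (t * M.norm I.1) : ℂ))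
    (fun I => hconv I.1 s) (by
      simp only [hnorm]
      exact ((M.summable_norm s.re hs).comp_injective Subtype.val_injective).mul_right _)
  have h2 : mellin (M.classCount W g) s = ∫ t in Ioi (0 : ℝ), ∑' I : {I // M.cls I = g},
      (t : ℂ) ^ (s - 1) • (W (t * M.norm I.1) : ℂ) := by
    simp only [mellin, classCount, smul_eq_mul, tsum_mul_left]
  rw [h2, ← key.tsum_eq]
  have h3 (I : {I // M.cls I = g}) : ∫ t in Ioi (0 : ℝ), (t : ℂ) ^ (s - 1) •
      (W (t * M.norm I.1) : ℂ) = (M.norm I.1 : ℂ) ^ (-s) * mellin (fun t => (W t : ℂ)) s :=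
    hmel I.1 s
  simp only [h3, tsum_mul_right, classZeta, series, one_mul]

end NormedMonoid

namespace NormedMonoid

open Filter Topology GenDirichlet MeasureTheory Set MellinBump

variable {S P G : Type*} [CommMonoid S] [CommGroup G] [Finite G] (M : NormedMonoid S P G)

/-- The difference between the smoothed counting function and its main term. -/
noncomputable def countError (W : ℝ → ℝ) (κ : ℝ) (g : G) (t : ℝ) : ℂ :=
  M.classCount W g t - κ * (Ioc (0 : ℝ) 1).indicator (fun t : ℝ => (t : ℂ) ^ (-1 : ℂ)) t

variable {W : ℝ → ℝ} {a κ : ℝ} {g : G}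

theorem locallyIntegrableOn_countError (hW : ∀ x, W x ≠ 0 → x ∈ Icc a 1) (hWc : Continuous W) :
    LocallyIntegrableOn (M.countError W κ g) (Ioi 0) := by
  refine ((M.continuousOn_classCount g hW hWc).locallyIntegrableOn measurableSet_Ioi).sub ?_
  refine (locallyIntegrableOn_iff isOpen_Ioi.isLocallyClosed).2 fun K hK hKc => ?_
  have hc : ContinuousOn (fun t : ℝ => (t : ℂ) ^ (-1 : ℂ)) K := fun t ht =>
    (Complex.continuousAt_ofReal_cpow_const t _ (Or.inr (hK ht : 0 < t).ne')).continuousWithinAt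
  exact ((hc.integrableOn_compact hKc).indicator measurableSet_Ioc).const_mul _

theorem countError_eq_zero (hW : ∀ x, W x ≠ 0 → x ∈ Icc a 1) {t : ℝ} (ht : 1 < t) :
    M.countError W κ g t = 0 := by
  rw [countError, indicator_of_notMem (fun h => not_le.2 ht h.2), mul_zero, sub_zero, classCount]
  convert tsum_zero with I
  rw [Complex.ofReal_eq_zero]
  by_contra h
  nlinarith [(hW _ h).2, M.one_le_norm I.1]

theorem differentiable_mellin_countError (hW : ∀ x, W x ≠ 0 → x ∈ Icc a 1) (hWc : Continuous W)
    (h : ∀ k : ℕ, ∃ C, ∀ t ∈ Ioc (0 : ℝ) 1, ∃ s,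
      HasSum (fun I : {I // M.cls I = g} => W (t * M.norm I.1)) s ∧ |s - κ / t| ≤ C * t ^ k)
    (s : ℂ) : MellinConvergent (M.countError W κ g) s ∧
      DifferentiableAt ℂ (mellin (M.countError W κ g)) s := by
  have hloc := M.locallyIntegrableOn_countError (κ := κ) (g := g) hW hWc
  have htop : M.countError W κ g =O[atTop] fun t => t ^ (-(s.re + 1)) :=
    isBigO_rpow_zero_of_eventually_eq
      (eventually_atTop_zero (b := 1) fun t ht => M.countError_eq_zero hW ht) _
  obtain ⟨k, hk⟩ := exists_nat_gt (-s.re)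
  obtain ⟨C, hC⟩ := h k
  have hbot : M.countError W κ g =O[𝓝[>] 0] fun t => t ^ (-(-(k : ℝ))) := by
    refine Asymptotics.IsBigO.of_bound C ?_
    filter_upwards [Ioc_mem_nhdsGT (zero_lt_one' ℝ)] with t ht
    obtain ⟨u, hu, hle⟩ := hC t ht
    rw [countError, indicator_of_mem ht, classCount, (Complex.hasSum_ofReal.2 hu).tsum_eq,
      Complex.cpow_neg_one, ← Complex.ofReal_inv, ← Complex.ofReal_mul, ← Complex.ofReal_sub,
      Complex.norm_real, neg_neg, Real.rpow_natCast, Real.norm_of_nonneg (pow_nonneg ht.1.le k)]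
    exact hle
  exact ⟨mellinConvergent_of_isBigO_rpow hloc htop (by linarith) hbot (by linarith),
    mellin_differentiableAt_of_isBigO_rpow hloc htop (by linarith) hbot (by linarith)⟩

theorem mellin_classCount_eq {s : ℂ} (hs : 1 < s.re)
    (h : MellinConvergent (M.countError W κ g) s) :
    mellin (M.classCount W g) s = mellin (M.countError W κ g) s + κ * (1 / (s - 1)) := by
  have h1 := hasMellin_cpow_Ioc (-1) (s := s) (by simpa using hs)
  have h2 := hasMellin_const_smul h1.1 (κ : ℂ)
  have h3 := hasMellin_add h h2.1
  rw [h2.2, h1.2, smul_eq_mul, ← sub_eq_add_neg] at h3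
  rw [← h3.2]
  congr 1
  ext t
  simp [countError]

/-- The partial zeta functions continue to a disc, with the same simple pole at `1`. -/
theorem exists_classZeta_continuation {R : ℝ} (hR : 2 ≤ R) : ∃ ρ : ℂ, ρ ≠ 0 ∧ ∀ g : G,
    ∃ H : ℂ → ℂ, DifferentiableOn ℂ H (Metric.ball (R : ℂ) (R + 1)) ∧ H 1 = ρ ∧
      ∀ s ∈ Metric.ball (R : ℂ) (R + 1), 1 < s.re → H s = (s - 1) * M.classZeta g s := by
  obtain ⟨W, a, x₀, ha, hW, hWs, hW0, hx₀, hre⟩ := exists_bump (T := R + 1) (by linarith)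
  obtain ⟨κ, hκ, hcount⟩ := M.smooth_count W a 1 x₀ ha hW hWs hW0 hx₀
  have hWc := hWs.continuous
  have hne (s : ℂ) (hs : s ∈ Metric.ball (R : ℂ) (R + 1)) :
      mellin (fun t => (W t : ℂ)) s ≠ 0 := fun h => by
    rw [Metric.mem_ball, Complex.dist_eq] at hs
    have h1 := hre s (((Complex.abs_im_le_norm (s - R)).trans hs.le).trans' (by simp))
    rw [h] at h1
    exact lt_irrefl _ h1
  have h1mem : (1 : ℂ) ∈ Metric.ball (R : ℂ) (R + 1) := by
    rw [Metric.mem_ball, Complex.dist_eq, ← Complex.ofReal_one, ← Complex.ofReal_sub,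
      Complex.norm_real, Real.norm_eq_abs, abs_lt]
    constructor <;> linarith
  refine ⟨κ / mellin (fun t => (W t : ℂ)) 1, div_ne_zero (by exact_mod_cast hκ.ne') (hne 1 h1mem),
    fun g => ?_⟩
  have hB := M.differentiable_mellin_countError hW hWc (hcount g)
  refine ⟨fun s => (κ + (s - 1) * mellin (M.countError W κ g) s) / mellin (fun t => (W t : ℂ)) s,
    fun s hs => ?_, by simp, fun s hs hs1 => ?_⟩
  · refine DifferentiableAt.differentiableWithinAt ?_
    exact (((differentiableAt_id.sub_const 1).mul (hB s).2).const_add _).div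
      (differentiable_mellin_bump ha hW hWc s) (hne s hs)
  · have e1 := M.hasMellin_classCount g ha hW hW0 hWc hs1
    rw [M.mellin_classCount_eq hs1 (hB s).1] at e1
    have hs0 : s - 1 ≠ 0 := fun h => by
      rw [sub_eq_zero] at h
      simp [h] at hs1
    rw [div_eq_iff (hne s hs), mul_assoc, ← e1, mul_add]
    field_simp
    ring

theorem L_eq_sum [Fintype G] (χ : G →* ℂˣ) {s : ℂ} (hs : 1 < s.re) :
    M.L χ s = ∑ g, (χ g : ℂ) * M.classZeta g s := by
  have hsum := (M.admissible_L χ).summable M.norm_pos hs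
  have h := hsum.hasSum
  have e := (Equiv.sigmaFiberEquiv M.cls).hasSum_iff.2 h
  have e2 := e.summable.tsum_sigma
  rw [e.tsum_eq] at e2
  rw [L, series, e2, tsum_fintype]
  refine Finset.sum_congr rfl fun g _ => ?_
  rw [classZeta, series, ← tsum_mul_left]
  refine tsum_congr fun I => ?_
  simp [Equiv.sigmaFiberEquiv, I.2]

theorem sum_char_eq_zero [Fintype G] {χ : G →* ℂˣ} (hχ : χ ≠ 1) : ∑ g, (χ g : ℂ) = 0 := by
  have h : (Units.coeHom ℂ).comp χ ≠ 1 := fun h => hχ <| by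
    ext g
    simpa using DFunLike.congr_fun h g
  simpa using sum_hom_units_eq_zero _ h

/-- The `L`-function of a nontrivial character continues holomorphically, and that of the trivial
character has a simple pole. -/
theorem exists_L_continuation {R : ℝ} (hR : 2 ≤ R) (χ : G →* ℂˣ) :
    ∃ H : ℂ → ℂ, DifferentiableOn ℂ H (Metric.ball (R : ℂ) (R + 1)) ∧ (H 1 = 0 ↔ χ ≠ 1) ∧
      ∀ s ∈ Metric.ball (R : ℂ) (R + 1), 1 < s.re → H s = (s - 1) * M.L χ s := by
  have := Fintype.ofFinite G
  obtain ⟨ρ, hρ, h⟩ := M.exists_classZeta_continuation hR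
  choose H hd h1 hH using h
  refine ⟨fun s => ∑ g, (χ g : ℂ) * H g s, ?_, ?_, fun s hs hs1 => ?_⟩
  · exact DifferentiableOn.fun_sum fun g _ => (hd g).const_mul _
  · simp only [h1, ← Finset.sum_mul, mul_eq_zero, hρ, or_false]
    refine ⟨fun h hχ => ?_, sum_char_eq_zero⟩
    simp [hχ] at h
  · rw [M.L_eq_sum χ hs1, Finset.mul_sum]
    refine Finset.sum_congr rfl fun g _ => ?_
    rw [hH g s hs hs1]
    ring

end NormedMonoid

namespace NormedMonoid

open Filter Topology GenDirichlet
open scoped ComplexOrder Classical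

variable {S P G : Type*} [CommMonoid S] [CommGroup G] [Finite G] (M : NormedMonoid S P G)

theorem sum_char_apply [Fintype (G →* ℂˣ)] (a : G) :
    ∑ χ : G →* ℂˣ, (χ a : ℂ) = if a = 1 then (Nat.card G : ℂ) else 0 := by
  split_ifs with h
  · simp [h, ← CommGroup.card_monoidHom_of_hasEnoughRootsOfUnity G ℂ, Nat.card_eq_fintype_card]
  · obtain ⟨φ, hφ⟩ := CommGroup.exists_apply_ne_one_of_hasEnoughRootsOfUnity G ℂ h
    have hne : (Units.coeHom ℂ).comp (MonoidHom.eval a : (G →* ℂˣ) →* ℂˣ) ≠ 1 := fun e => hφ <| by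
      ext
      simpa using DFunLike.congr_fun e φ
    simpa using sum_hom_units_eq_zero _ hne

/-- The coefficients of the prime powers in a class. -/
noncomputable def classCoeff (g : G) (x : P × ℕ) : ℂ :=
  if M.cls (M.prime x.1) ^ (x.2 + 1) = g then Nat.card G * Real.log (M.norm (M.prime x.1)) else 0

theorem classCoeff_nonneg (g : G) (x : P × ℕ) : 0 ≤ M.classCoeff g x := by
  rw [classCoeff]
  split_ifs
  · exact_mod_cast mul_nonneg (Nat.cast_nonneg _) (M.log_norm_prime_nonneg x.1)
  · exact le_rfl

theorem admissible_classCoeff (g : G) : Admissible M.primePowNorm (M.classCoeff g) := by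
  intro σ hσ
  refine ((M.admissible_logCoeff 1 σ hσ).mul_left (Nat.card G : ℝ)).of_nonneg_of_le
    (fun x => by positivity) fun x => ?_
  rw [← mul_assoc]
  gcongr
  rw [classCoeff, logCoeff]
  split_ifs
  · simp
  · simp only [norm_zero]; positivity

theorem sum_mul_logSeries [Fintype (G →* ℂˣ)] (g : G) {s : ℂ} (hs : 1 < s.re) :
    ∑ χ : G →* ℂˣ, (χ g⁻¹ : ℂ) * M.logSeries χ s = series M.primePowNorm (M.classCoeff g) s := by
  have h (χ : G →* ℂˣ) := (M.admissible_logCoeff χ).summable M.primePowNorm_pos hs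
  simp only [logSeries, series, ← tsum_mul_left]
  rw [← Summable.tsum_finsetSum fun χ _ => (h χ).mul_left _]
  refine tsum_congr fun x => ?_
  have e (χ : G →* ℂˣ) : (χ g⁻¹ : ℂ) * (M.logCoeff χ x * (M.primePowNorm x : ℂ) ^ (-s)) =
      Real.log (M.norm (M.prime x.1)) * (M.primePowNorm x : ℂ) ^ (-s) *
        (χ (g⁻¹ * M.cls (M.prime x.1) ^ (x.2 + 1)) : ℂ) := by
    rw [logCoeff, map_mul, map_pow, Units.val_mul, Units.val_pow_eq_pow_val]
    ring
  simp only [e, ← Finset.mul_sum, sum_char_apply, classCoeff, inv_mul_eq_one, eq_comm (a := g)]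
  split_ifs <;> ring

/-- Whether a prime power is a power of `p₀ ^ h`, where `h` is the order of the class group. -/
def IsFixedPower (G : Type*) (p₀ : P) (x : P × ℕ) : Prop := x.1 = p₀ ∧ Nat.card G ∣ x.2 + 1

/-- The coefficients `M.classCoeff 1` with those at the powers of `p₀ ^ h` removed. -/
noncomputable def reducedCoeff (p₀ : P) (x : P × ℕ) : ℂ :=
  if IsFixedPower G p₀ x then 0 else M.classCoeff 1 x

theorem series_reducedCoeff (p₀ : P) {s : ℂ} (hs : 1 < s.re) :
    series M.primePowNorm (M.reducedCoeff p₀) s *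
        (1 - (M.norm (M.prime p₀) : ℂ) ^ (-(Nat.card G * s))) =
      series M.primePowNorm (M.classCoeff 1) s *
        (1 - (M.norm (M.prime p₀) : ℂ) ^ (-(Nat.card G * s))) -
      Nat.card G * Real.log (M.norm (M.prime p₀)) *
        (M.norm (M.prime p₀) : ℂ) ^ (-(Nat.card G * s)) := by
  set h := Nat.card G with hh
  have hpos : 0 < h := Nat.card_pos
  set q := M.norm (M.prime p₀) with hq
  set z : ℂ := (q : ℂ) ^ (-(h * s)) with hz
  have hq2 : 2 ≤ q := M.two_le_norm_prime p₀
  have hz1 : ‖z‖ < 1 := by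
    rw [hz, Complex.norm_natCast_cpow_of_pos (by omega)]
    refine Real.rpow_lt_one_of_one_lt_of_neg (by exact_mod_cast hq2) ?_
    have : (0 : ℝ) < h := by exact_mod_cast hpos
    rw [Complex.neg_re, ← Complex.ofReal_natCast, Complex.re_ofReal_mul]
    nlinarith
  have hfull := (M.admissible_classCoeff 1).summable M.primePowNorm_pos hs
  let e : ℕ → P × ℕ := fun j => (p₀, h * (j + 1) - 1)
  have he1 (j : ℕ) : h * (j + 1) - 1 + 1 = h * (j + 1) := Nat.sub_add_cancel (by nlinarith)
  have he : Function.Injective e := fun i j hij => by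
    have h1 := congrArg (· + 1) (Prod.ext_iff.1 hij).2
    simp only [e, he1] at h1
    exact Nat.succ_injective (Nat.eq_of_mul_eq_mul_left hpos h1)
  have hgeo : HasSum (fun j : ℕ => (h * Real.log q : ℂ) * z ^ (j + 1))
      (h * Real.log q * (z * (1 - z)⁻¹)) := by
    simp only [pow_succ']
    exact ((hasSum_geometric_of_norm_lt_one hz1).mul_left z).mul_left _
  have hdiff : HasSum (fun x => if IsFixedPower G p₀ x then
      M.classCoeff 1 x * (M.primePowNorm x : ℂ) ^ (-s) else 0)
      (h * Real.log q * (z * (1 - z)⁻¹)) := by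
    rw [← he.hasSum_iff]
    · convert! hgeo using 2 with j
      have hfix : IsFixedPower G p₀ (e j) := ⟨rfl, by simp only [e, he1]; exact Dvd.intro _ rfl⟩
      simp only [Function.comp, if_pos hfix]
      rw [classCoeff, primePowNorm, natCast_pow_cpow]
      simp only [e, he1]
      rw [if_pos (by rw [pow_mul, pow_card_eq_one', one_pow]), ← hh, ← hq, pow_mul, hz,
        ← mul_neg, Complex.cpow_nat_mul]
    · intro x hx
      rw [if_neg]
      rintro ⟨h1, j, hj⟩
      refine hx ⟨j - 1, Prod.ext h1.symm ?_⟩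
      have hj0 : j ≠ 0 := by rintro rfl; simp at hj
      have : j - 1 + 1 = j := Nat.succ_pred_eq_of_pos (Nat.pos_of_ne_zero hj0)
      rw [← hh] at hj
      simp only [e]
      rw [this, ← hj, Nat.add_sub_cancel]
  have hred := hfull.hasSum.sub hdiff
  have : series M.primePowNorm (M.reducedCoeff p₀) s =
      series M.primePowNorm (M.classCoeff 1) s - h * Real.log q * (z * (1 - z)⁻¹) := by
    refine Eq.trans ?_ hred.tsum_eq
    refine tsum_congr fun x => ?_
    rw [reducedCoeff]
    split_ifs <;> simp
  have hz0 : 1 - z ≠ 0 := fun h0 => by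
    rw [sub_eq_zero] at h0
    simp [← h0] at hz1
  rw [this]
  field_simp

theorem exists_nat_L_ne_zero (M : NormedMonoid S P G) :
    ∃ R : ℕ, 2 ≤ R ∧ ∀ χ : G →* ℂˣ, M.L χ R ≠ 0 := by
  set C := ∑' I, (M.norm I : ℝ) ^ (-2 : ℝ) with hC
  have hsum := M.summable_norm 2 (by norm_num)
  have hC0 : 0 ≤ C := tsum_nonneg fun I => by positivity
  obtain ⟨n, hn⟩ := exists_pow_lt_of_lt_one (show (0 : ℝ) < (C + 1)⁻¹ by positivity)
    (show (1 / 2 : ℝ) < 1 by norm_num)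
  refine ⟨2 + n, by omega, fun χ h0 => ?_⟩
  have hR : 1 < ((2 + n : ℕ) : ℂ).re := by
    rw [Complex.natCast_re]
    push_cast
    linarith [(Nat.cast_nonneg n : (0 : ℝ) ≤ n)]
  have hs := (M.admissible_L χ).summable M.norm_pos hR
  have h1 := hs.tsum_eq_add_tsum_ite 1
  rw [← series, ← L, h0] at h1
  have h2 : ‖∑' I, if I = 1 then 0 else (χ (M.cls I) : ℂ) * (M.norm I : ℂ) ^
      (-((2 + n : ℕ) : ℂ))‖ ≤ (1 / 2) ^ n * C := by
    rw [hC, ← tsum_mul_left]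
    refine tsum_of_norm_bounded (hsum.mul_left _).hasSum fun I => ?_
    split_ifs with hI
    · simp only [norm_zero]; positivity
    · have hI2 : 2 ≤ M.norm I := by
        have := M.norm_pos I
        have := mt (M.eq_one_of_norm I) hI
        omega
      have hI0 : (0 : ℝ) < M.norm I := by exact_mod_cast M.norm_pos I
      rw [norm_term M.norm_pos (fun I => (χ (M.cls I) : ℂ)), norm_char, one_mul, Complex.natCast_re,
        Nat.cast_add, Nat.cast_ofNat, neg_add, Real.rpow_add hI0, mul_comm]
      gcongr
      · rw [Real.rpow_neg hI0.le, Real.rpow_natCast, one_div, inv_pow]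
        gcongr
        exact_mod_cast hI2
  have h3 : (1 : ℝ) ≤ (1 / 2) ^ n * C := by
    refine le_trans ?_ h2
    rw [← norm_neg, ← eq_neg_of_add_eq_zero_left h1.symm]
    simp
  have h4 : (1 / 2 : ℝ) ^ n * (C + 1) < 1 := by
    have := mul_lt_mul_of_pos_right hn (show (0 : ℝ) < C + 1 by positivity)
    rwa [inv_mul_cancel₀ (by positivity)] at this
  have : (0 : ℝ) < (1 / 2) ^ n := by positivity
  linarith

end NormedMonoid

namespace NormedMonoid

open Filter Topology GenDirichlet
open scoped ComplexOrder Classical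

variable {S P G : Type*} [CommMonoid S] [CommGroup G] [Finite G] (M : NormedMonoid S P G)

theorem hasDerivAt_prod_L [Fintype (G →* ℂˣ)] {s : ℂ} (hs : 1 < s.re) :
    HasDerivAt (fun s => ∏ χ : G →* ℂˣ, M.L χ s)
      (-(series M.primePowNorm (M.classCoeff 1) s * ∏ χ : G →* ℂˣ, M.L χ s)) s := by
  refine (HasDerivAt.fun_finsetProd fun χ _ => M.hasDerivAt_L χ hs).congr_deriv ?_
  rw [← M.sum_mul_logSeries 1 hs, Finset.sum_mul, ← Finset.sum_neg_distrib]
  refine Finset.sum_congr rfl fun χ hχ => ?_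
  rw [← Finset.mul_prod_erase _ _ hχ]
  simp
  ring

/-- The product of all `L`-functions with the factor of `p₀ ^ h` removed. -/
noncomputable def reducedProd [Fintype (G →* ℂˣ)] (p₀ : P) (s : ℂ) : ℂ :=
  (∏ χ : G →* ℂˣ, M.L χ s) * (1 - (M.norm (M.prime p₀) : ℂ) ^ (-(Nat.card G * s)))

theorem differentiable_factor (p₀ : P) :
    Differentiable ℂ fun s : ℂ => 1 - (M.norm (M.prime p₀) : ℂ) ^ (-(Nat.card G * s)) := fun s => by
  refine DifferentiableAt.const_sub ?_ _
  exact ((differentiableAt_id.const_mul _).neg).const_cpow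
    (Or.inl (by exact_mod_cast (M.norm_pos _).ne'))

theorem hasDerivAt_reducedProd [Fintype (G →* ℂˣ)] (p₀ : P) {s : ℂ} (hs : 1 < s.re) :
    HasDerivAt (M.reducedProd p₀)
      (-(series M.primePowNorm (M.reducedCoeff p₀) s * M.reducedProd p₀ s)) s := by
  have h1 : HasDerivAt (fun s : ℂ => 1 - (M.norm (M.prime p₀) : ℂ) ^ (-(Nat.card G * s)))
      (Nat.card G * Real.log (M.norm (M.prime p₀)) *
        (M.norm (M.prime p₀) : ℂ) ^ (-(Nat.card G * s))) s := by
    have := (((((hasDerivAt_id s).const_mul (Nat.card G : ℂ)).neg).const_cpow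
      (c := (M.norm (M.prime p₀) : ℂ))
      (Or.inl (by exact_mod_cast (M.norm_pos _).ne'))).const_sub 1)
    refine this.congr_deriv ?_
    rw [← Complex.natCast_log]
    simp
    ring
  refine ((M.hasDerivAt_prod_L hs).mul h1).congr_deriv ?_
  rw [reducedProd]
  linear_combination (∏ χ : G →* ℂˣ, M.L χ s) * series_reducedCoeff M p₀ hs

theorem admissible_reducedCoeff (p₀ : P) : Admissible M.primePowNorm (M.reducedCoeff p₀) :=
  (M.admissible_classCoeff 1).mono fun x => by
    rw [reducedCoeff]
    split_ifs <;> simp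

theorem reducedCoeff_nonneg (p₀ : P) (x : P × ℕ) : 0 ≤ M.reducedCoeff p₀ x := by
  rw [reducedCoeff]
  split_ifs
  exacts [le_rfl, M.classCoeff_nonneg 1 x]

/-- The product of all `L`-functions does not extend holomorphically to a disc containing `0`. -/
theorem not_exists_reducedProd_continuation [Fintype (G →* ℂˣ)] (p₀ : P) {R : ℕ} (hR : 2 ≤ R)
    (hne : ∀ χ : G →* ℂˣ, M.L χ R ≠ 0) {Z : ℂ → ℂ}
    (hZ : DifferentiableOn ℂ Z (Metric.ball (R : ℂ) (R + 1)))
    (hZL : ∀ s ∈ Metric.ball (R : ℂ) (R + 1), 1 < s.re → Z s = ∏ χ : G →* ℂˣ, M.L χ s) :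
    False := by
  have hR' : (2 : ℝ) ≤ R := by exact_mod_cast hR
  let Q : ℂ → ℂ := fun s : ℂ => 1 - (M.norm (M.prime p₀) : ℂ) ^ (-(Nat.card G * s))
  have hRmem : (R : ℂ) ∈ Metric.ball (R : ℂ) (R + 1) := Metric.mem_ball_self (by linarith)
  have hRre : 1 < (R : ℂ).re := by rw [Complex.natCast_re]; linarith
  let c := Z R * Q R
  have hc : c ≠ 0 := by
    refine mul_ne_zero ?_ ?_
    · rw [hZL R hRmem hRre]
      exact Finset.prod_ne_zero_iff.2 fun χ _ => hne χ
    · simp only [Q, ne_eq, sub_eq_zero]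
      intro h
      have h1 : ‖(1 : ℂ)‖ = ‖_‖ := congrArg (fun z : ℂ => ‖z‖) h
      rw [norm_one, Complex.norm_natCast_cpow_of_pos (M.norm_pos _)] at h1
      refine (Real.rpow_lt_one_of_one_lt_of_neg ?_ ?_).ne h1.symm
      · exact_mod_cast M.two_le_norm_prime p₀
      · rw [Complex.neg_re, ← Nat.cast_mul, Complex.natCast_re, neg_lt_zero]
        exact_mod_cast Nat.mul_pos Nat.card_pos (by omega)
  let Y : ℂ → ℂ := fun s => c⁻¹ * (Z s * Q s)
  have hY : DifferentiableOn ℂ Y (Metric.ball (R : ℂ) (R + 1)) :=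
    (hZ.mul (M.differentiable_factor p₀).differentiableOn).const_mul _
  have hnhds : ∀ᶠ s in 𝓝 (R : ℂ), s ∈ Metric.ball (R : ℂ) (R + 1) ∧ 1 < s.re :=
    (Metric.isOpen_ball.eventually_mem hRmem).and (isOpen_one_lt_re.eventually_mem hRre)
  have hYE : ∀ᶠ s in 𝓝 (R : ℂ), Y s = c⁻¹ * M.reducedProd p₀ s := by
    filter_upwards [hnhds] with s hs
    simp only [Y, hZL s hs.1 hs.2, reducedProd, Q]
  have hderiv : deriv Y =ᶠ[𝓝 (R : ℂ)]
      fun s => -(series M.primePowNorm (M.reducedCoeff p₀) s * Y s) := by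
    filter_upwards [hYE.eventually_nhds, hnhds] with s hs hs'
    have hd := ((M.hasDerivAt_reducedProd p₀ hs'.2).const_mul c⁻¹).congr_of_eventuallyEq hs
    rw [hd.deriv, hs.self_of_nhds]
    ring
  have hYR : Y R = 1 := inv_mul_cancel₀ hc
  have halt := alternating_of_deriv_eq (hY.analyticAt (Metric.isOpen_ball.mem_nhds hRmem))
    (analyticAt_series (M.admissible_reducedCoeff p₀) M.primePowNorm_pos hRre) hderiv
    (fun n => by
      have := alternating_series M.primePowNorm_pos n (M.admissible_reducedCoeff p₀)
        (M.reducedCoeff_nonneg p₀) (σ := R) (by linarith)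
      simpa using this) (by rw [hYR]; exact zero_le_one)
  have hfin := apply_le_of_alternating_ball (c := R) (r := R + 1) (x := 0) (f := Y)
    (by simpa using hY) (by simpa using halt) (by linarith) (by linarith)
  rw [Complex.ofReal_natCast, hYR, Complex.ofReal_zero] at hfin
  have hY0 : Y 0 = 0 := by simp [Y, Q]
  rw [hY0] at hfin
  exact absurd hfin (by norm_num)

theorem exists_L_continuation_ne_zero (p₀ : P) {χ : G →* ℂˣ} (hχ : χ ≠ 1) :
    ∃ E : ℂ → ℂ, AnalyticAt ℂ E 1 ∧ E 1 ≠ 0 ∧ ∀ᶠ s in 𝓝 1, 1 < s.re → E s = M.L χ s := by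
  have := Fintype.ofFinite (G →* ℂˣ)
  obtain ⟨R, hR, hne⟩ := M.exists_nat_L_ne_zero
  have hR' : (2 : ℝ) ≤ R := by exact_mod_cast hR
  have h := M.exists_L_continuation hR'
  rw [Complex.ofReal_natCast] at h
  choose H hd h1 hH using h
  have hmem : (1 : ℂ) ∈ Metric.ball (R : ℂ) (R + 1) := by
    rw [Metric.mem_ball, Complex.dist_eq, ← Complex.ofReal_one, ← Complex.ofReal_natCast,
      ← Complex.ofReal_sub, Complex.norm_real, Real.norm_eq_abs, abs_lt]
    constructor <;> linarith
  have hnhds := Metric.isOpen_ball.mem_nhds hmem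
  have hne1 {s : ℂ} (hs : 1 < s.re) : s ≠ 1 := fun h => by simp [h] at hs
  let E (ψ : G →* ℂˣ) : ℂ → ℂ := dslope (H ψ) 1
  have hE (ψ : G →* ℂˣ) : DifferentiableOn ℂ (E ψ) (Metric.ball (R : ℂ) (R + 1)) :=
    (Complex.differentiableOn_dslope hnhds).2 (hd ψ)
  have hEL (ψ : G →* ℂˣ) (hψ : ψ ≠ 1) (s : ℂ) (hs : s ∈ Metric.ball (R : ℂ) (R + 1))
      (hs1 : 1 < s.re) : E ψ s = M.L ψ s := by
    have h2 := sub_smul_dslope (H ψ) 1 s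
    rw [(h1 ψ).2 hψ, sub_zero, hH ψ s hs hs1, smul_eq_mul] at h2
    exact mul_left_cancel₀ (sub_ne_zero.2 (hne1 hs1)) h2
  refine ⟨E χ, (hE χ).analyticAt hnhds, fun hE0 => ?_, ?_⟩
  · refine M.not_exists_reducedProd_continuation p₀ hR hne (Z := fun s =>
      H 1 s * (dslope (E χ) 1 s * ∏ ψ ∈ (Finset.univ.erase 1).erase χ, E ψ s)) ?_ ?_
    · exact (hd 1).mul (((Complex.differentiableOn_dslope hnhds).2 (hE χ)).mul
        (DifferentiableOn.fun_finsetProd fun ψ _ => hE ψ))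
    · intro s hs hs1
      have h2 := sub_smul_dslope (E χ) 1 s
      rw [hE0, sub_zero, hEL χ hχ s hs hs1, smul_eq_mul] at h2
      rw [← Finset.mul_prod_erase _ _ (Finset.mem_univ (1 : G →* ℂˣ)),
        ← Finset.mul_prod_erase _ _ (Finset.mem_erase.2 ⟨hχ, Finset.mem_univ χ⟩), ← h2,
        hH 1 s hs hs1, Finset.prod_congr rfl fun ψ hψ =>
          hEL ψ (Finset.ne_of_mem_erase (Finset.mem_of_mem_erase hψ)) s hs hs1]
      ring
  · filter_upwards [hnhds] with s hs hs1 using hEL χ hχ s hs hs1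

end NormedMonoid

namespace NormedMonoid

open Filter Topology GenDirichlet

variable {S P G : Type*} [CommMonoid S] [CommGroup G] [Finite G] (M : NormedMonoid S P G)

theorem tendsto_sub_one_mul_logSeries_of_analyticAt (χ : G →* ℂˣ) {E : ℂ → ℂ} (n : ℕ)
    (hE : AnalyticAt ℂ E 1) (hE0 : E 1 ≠ 0)
    (h : ∀ᶠ s in 𝓝 1, 1 < s.re → E s = (s - 1) ^ n * M.L χ s) :
    Tendsto (fun σ : ℝ => ((σ : ℂ) - 1) * M.logSeries χ σ) (𝓝[>] 1) (𝓝 n) := by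
  have hlim : Tendsto (fun s : ℂ => n - (s - 1) * (deriv E s / E s)) (𝓝 1) (𝓝 n) := by
    have : ContinuousAt (fun s : ℂ => n - (s - 1) * (deriv E s / E s)) 1 :=
      continuousAt_const.sub ((continuousAt_id.sub continuousAt_const).mul
        (hE.deriv.continuousAt.div hE.continuousAt hE0))
    simpa [ContinuousAt] using this
  have hof : Tendsto (fun σ : ℝ => (σ : ℂ)) (𝓝[>] 1) (𝓝 1) :=
    (Complex.continuous_ofReal.tendsto' 1 1 Complex.ofReal_one).mono_left nhdsWithin_le_nhds
  refine (hlim.comp hof).congr' ?_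
  filter_upwards [hof.eventually h.eventually_nhds,
    hof.eventually (hE.continuousAt.eventually_ne hE0), self_mem_nhdsWithin] with σ hσ hne hσ1
  have hre : 1 < (σ : ℂ).re := hσ1
  have hd := ((((hasDerivAt_id (σ : ℂ)).sub_const 1).pow n).mul
    (M.hasDerivAt_L χ hre)).congr_of_eventuallyEq (f₁ := E) (by
      filter_upwards [hσ, isOpen_one_lt_re.eventually_mem hre] with s hs hs1 using hs hs1)
  have hEσ := hσ.self_of_nhds hre
  have hder := hd.deriv
  simp only [id_eq, Pi.pow_apply, mul_one] at hder
  simp only [Function.comp]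
  field_simp
  rw [hder, hEσ]
  cases n with
  | zero => simp only [Nat.cast_zero, pow_zero]; ring
  | succ n => simp only [Nat.cast_succ, Nat.add_sub_cancel]; ring

theorem tendsto_sub_one_mul_logSeries_one :
    Tendsto (fun σ : ℝ => ((σ : ℂ) - 1) * M.logSeries 1 σ) (𝓝[>] 1) (𝓝 1) := by
  obtain ⟨H, hd, h1, hH⟩ := M.exists_L_continuation le_rfl 1
  have hnhds : Metric.ball ((2 : ℝ) : ℂ) (2 + 1) ∈ 𝓝 (1 : ℂ) := by
    refine Metric.isOpen_ball.mem_nhds ?_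
    rw [Metric.mem_ball, Complex.dist_eq]
    norm_num
  have := M.tendsto_sub_one_mul_logSeries_of_analyticAt 1 1 (hd.analyticAt hnhds)
    (fun h => h1.1 h rfl) (by
      filter_upwards [hnhds] with s hs hs1
      rw [pow_one, hH s hs hs1])
  simpa using this

theorem nonempty_prime (M : NormedMonoid S P G) : Nonempty P := by
  by_contra hP
  rw [not_nonempty_iff] at hP
  have h := M.tendsto_sub_one_mul_logSeries_one
  simp only [logSeries, series, tsum_empty, mul_zero] at h
  exact zero_ne_one (tendsto_nhds_unique tendsto_const_nhds h)

theorem tendsto_sub_one_mul_logSeries {χ : G →* ℂˣ} (hχ : χ ≠ 1) :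
    Tendsto (fun σ : ℝ => ((σ : ℂ) - 1) * M.logSeries χ σ) (𝓝[>] 1) (𝓝 0) := by
  obtain ⟨p₀⟩ := M.nonempty_prime
  obtain ⟨E, hE, hE0, h⟩ := M.exists_L_continuation_ne_zero p₀ hχ
  simpa using M.tendsto_sub_one_mul_logSeries_of_analyticAt χ 0 hE hE0 (by simpa using h)

open scoped Classical in
theorem tendsto_sub_one_mul_series_classCoeff (g : G) :
    Tendsto (fun σ : ℝ => ((σ : ℂ) - 1) * series M.primePowNorm (M.classCoeff g) σ)
      (𝓝[>] 1) (𝓝 1) := by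
  have := Fintype.ofFinite (G →* ℂˣ)
  have h : Tendsto (fun σ : ℝ => ∑ χ : G →* ℂˣ, (χ g⁻¹ : ℂ) * (((σ : ℂ) - 1) * M.logSeries χ σ))
      (𝓝[>] 1) (𝓝 (∑ χ : G →* ℂˣ, (χ g⁻¹ : ℂ) * if χ = 1 then 1 else 0)) := by
    refine tendsto_finsetSum _ fun χ _ => Tendsto.const_mul _ ?_
    split_ifs with hχ
    · exact hχ ▸ M.tendsto_sub_one_mul_logSeries_one
    · exact M.tendsto_sub_one_mul_logSeries hχ
  have hsum : ∑ χ : G →* ℂˣ, (χ g⁻¹ : ℂ) * (if χ = 1 then 1 else 0 : ℂ) = 1 := by simp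
  rw [hsum] at h
  refine h.congr' ?_
  filter_upwards [self_mem_nhdsWithin] with σ hσ
  rw [← M.sum_mul_logSeries g (s := σ) hσ, Finset.mul_sum]
  exact Finset.sum_congr rfl fun χ _ => mul_left_comm _ _ _

theorem summable_log_mul_rpow_neg_two :
    Summable fun p : P => Real.log (M.norm (M.prime p)) * ((M.norm (M.prime p) : ℝ) ^ 2)⁻¹ := by
  have hinj : Function.Injective fun p : P => (p, 0) := fun p q h => (Prod.ext_iff.1 h).1
  refine ((M.admissible_logCoeff 1 2 one_lt_two).comp_injective hinj).congr fun p => ?_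
  have := abs_of_nonneg (M.log_norm_prime_nonneg p)
  simp only [Function.comp, logCoeff, primePowNorm, zero_add, pow_one, norm_mul, norm_char,
    Complex.norm_real, Real.norm_eq_abs, mul_one, this]
  rw [Real.rpow_neg (Nat.cast_nonneg _), Real.rpow_two]

theorem inv_pow_add_two_le {x : ℝ} (hx : 2 ≤ x) (k : ℕ) :
    (x ^ (k + 2))⁻¹ ≤ (x ^ 2)⁻¹ * (1 / 2) ^ k := by
  have : (x ^ k)⁻¹ ≤ (1 / 2) ^ k := by
    rw [one_div, inv_pow]
    gcongr
  rw [pow_add, mul_inv, mul_comm]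
  gcongr

open scoped Classical in
theorem infinite_prime_cls_eq (g : G) : {p : P | M.cls (M.prime p) = g}.Infinite := by
  intro hfin
  let b (x : P × ℕ) : ℝ := Nat.card G *
    ((if M.cls (M.prime x.1) = g ∧ x.2 = 0 then Real.log (M.norm (M.prime x.1)) else 0) +
      2 * (Real.log (M.norm (M.prime x.1)) * ((M.norm (M.prime x.1) : ℝ) ^ 2)⁻¹ * (1 / 2) ^ x.2))
  have hb : Summable b := by
    refine .mul_left _ (.add ?_ (.mul_left _ ?_))
    · refine summable_of_hasFiniteSupport ((hfin.prod (Set.finite_singleton 0)).subset fun x hx => ?_)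
      by_contra hx'
      exact hx (if_neg hx')
    · exact M.summable_log_mul_rpow_neg_two.mul_of_nonneg summable_geometric_two
        (fun p => mul_nonneg (M.log_norm_prime_nonneg p) (by positivity)) (fun k => by positivity)
  have hle {σ : ℝ} (hσ : 1 < σ) : ‖series M.primePowNorm (M.classCoeff g) σ‖ ≤ ∑' x, b x := by
    refine tsum_of_norm_bounded hb.hasSum fun x => ?_
    obtain ⟨p, k⟩ := x
    have hlog := M.log_norm_prime_nonneg p
    have hN : (2 : ℝ) ≤ M.norm (M.prime p) := by exact_mod_cast M.two_le_norm_prime p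
    have hb0 : 0 ≤ b (p, k) := by
      refine mul_nonneg (Nat.cast_nonneg _) (add_nonneg ?_ (by positivity))
      split_ifs
      exacts [hlog, le_rfl]
    have hpow : (M.primePowNorm (p, k) : ℝ) ^ (-σ) ≤
        ((M.norm (M.prime p) : ℝ) ^ (k + 1))⁻¹ := by
      rw [primePowNorm, Nat.cast_pow, ← Real.rpow_neg_one]
      exact Real.rpow_le_rpow_of_exponent_le (one_le_pow₀ (by linarith)) (by linarith)
    rw [norm_term M.primePowNorm_pos, Complex.ofReal_re, classCoeff]
    split_ifs with hg
    · rw [norm_mul, Complex.norm_natCast, Complex.norm_real, Real.norm_of_nonneg hlog, mul_assoc]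
      refine mul_le_mul_of_nonneg_left ?_ (Nat.cast_nonneg _)
      cases k with
      | zero =>
        rw [if_pos ⟨by simpa using hg, rfl⟩]
        refine le_add_of_le_of_nonneg (mul_le_of_le_one_right hlog (hpow.trans ?_)) (by positivity)
        exact inv_le_one_of_one_le₀ (one_le_pow₀ (by linarith))
      | succ k =>
        rw [if_neg (by simp), zero_add]
        refine (mul_le_mul_of_nonneg_left (hpow.trans (inv_pow_add_two_le hN k)) hlog).trans_eq ?_
        simp only [pow_succ]
        ring
    · simpa using hb0
  have hlim : Tendsto (fun σ : ℝ => ((σ : ℂ) - 1) * series M.primePowNorm (M.classCoeff g) σ)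
      (𝓝[>] 1) (𝓝 0) := by
    refine squeeze_zero_norm' (a := fun σ => (σ - 1) * ∑' x, b x) ?_ ?_
    · filter_upwards [self_mem_nhdsWithin] with σ hσ
      have hσ' : 0 < σ - 1 := sub_pos.2 hσ
      rw [norm_mul, ← Complex.ofReal_one, ← Complex.ofReal_sub, Complex.norm_real,
        Real.norm_of_nonneg hσ'.le]
      exact mul_le_mul_of_nonneg_left (hle hσ) hσ'.le
    · refine Tendsto.mono_left ?_ nhdsWithin_le_nhds
      have : Continuous fun σ : ℝ => (σ - 1) * ∑' x, b x := by fun_prop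
      simpa using this.tendsto 1
  exact one_ne_zero (tendsto_nhds_unique (M.tendsto_sub_one_mul_series_classCoeff g) hlim)

end NormedMonoid

namespace NarrowRay

variable {F : Type*} [Field F] [NumberField F] {𝔣 : Ideal (𝓞 F)}

open Filter Asymptotics UniqueFactorizationMonoid
open scoped Classical nonZeroDivisors ContDiff

variable (F) in
theorem summable_absNorm_rpow_neg {σ : ℝ} (hσ : 1 < σ) :
    Summable fun I : Ideal (𝓞 F) => (Ideal.absNorm I : ℝ) ^ (-σ) := by
  let c (n : ℕ) : ℝ := Nat.card {I : Ideal (𝓞 F) // Ideal.absNorm I = n}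
  have hO : (fun n : ℕ => ∑ k ∈ Finset.Icc 1 n, c k) =O[atTop] fun n => (n : ℝ) ^ (1 : ℝ) := by
    refine isBigO_atTop_natCast_rpow_of_tendsto_div_rpow
      (((Ideal.tendsto_norm_le_div_atTop₀ F).comp tendsto_natCast_atTop_atTop).congr fun n ↦ ?_)
    simp only [Function.comp_apply, Nat.cast_le, ← Nat.cast_sum, Real.rpow_one, c]
    congr
    rw [← add_left_inj 1, ← Ideal.card_norm_le_eq_card_norm_le_add_one,
      show Finset.Icc 1 n = Finset.Ioc 0 n from Finset.Icc_succ_left_eq_Ioc _ _,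
      show 1 = Nat.card {I : Ideal (𝓞 F) // Ideal.absNorm I = 0} by
        simp [Ideal.absNorm_eq_zero_iff],
      Finset.sum_Ioc_add_eq_sum_Icc (n.zero_le),
      ← Finset.card_preimage_eq_sum_card_image_eq
        (fun k _ ↦ Ideal.finite_setOfPred_absNorm_eq k)]
    simp [Set.coe_eq_subtype]
  have hc : Summable fun n => c n * (n : ℝ) ^ (-σ) := by
    refine (LSeriesSummable_of_sum_norm_bigO_and_nonneg hO (fun n => Nat.cast_nonneg _)
      zero_le_one (s := σ) (by simpa using hσ)).norm.congr fun n => ?_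
    rcases eq_or_ne n 0 with rfl | hn
    · simp [Real.zero_rpow (by linarith : -σ ≠ 0)]
    · rw [LSeries.term_of_ne_zero hn, norm_div, Complex.norm_real,
        Real.norm_of_nonneg (Nat.cast_nonneg _),
        Complex.norm_natCast_cpow_of_pos (Nat.pos_of_ne_zero hn), Complex.ofReal_re,
        Real.rpow_neg (Nat.cast_nonneg _), div_eq_mul_inv]
  rw [← (Equiv.sigmaFiberEquiv (Ideal.absNorm : Ideal (𝓞 F) → ℕ)).summable_iff,
    summable_sigma_of_nonneg fun x => by simp only [Function.comp]; positivity]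
  have hval (n : ℕ) (I : {I : Ideal (𝓞 F) // Ideal.absNorm I = n}) :
      ((fun I : Ideal (𝓞 F) => (Ideal.absNorm I : ℝ) ^ (-σ)) ∘
        Equiv.sigmaFiberEquiv (Ideal.absNorm : Ideal (𝓞 F) → ℕ)) ⟨n, I⟩ = (n : ℝ) ^ (-σ) := by
    simp only [Function.comp, Equiv.sigmaFiberEquiv_apply, I.2]
  have hfin (n : ℕ) : Finite {I : Ideal (𝓞 F) // Ideal.absNorm I = n} :=
    (Ideal.finite_setOfPred_absNorm_eq n).to_subtype
  refine ⟨fun n => Summable.of_finite, hc.congr fun n => ?_⟩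
  simp only [hval, tsum_const, nsmul_eq_mul, c]

variable (𝔣) in
/-- The prime ideals coprime to `𝔣`. -/
abbrev CoprimePrime : Type _ := {p : Ideal (𝓞 F) // Prime p ∧ IsCoprime p 𝔣}

variable (𝔣) in
/-- The primes coprime to `𝔣`, as elements of the monoid of ideals coprime to `𝔣`. -/
def toCoprimeIdeals (p : CoprimePrime 𝔣) : coprimeIdeals 𝔣 := ⟨p, p.2.1.ne_zero, p.2.2⟩

theorem coprimeIdeals_dvd_iff {I J : coprimeIdeals 𝔣} :
    I ∣ J ↔ (I : Ideal (𝓞 F)) ∣ J := by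
  refine ⟨fun ⟨K, hK⟩ => ⟨K, by rw [hK, Submonoid.coe_mul]⟩, fun ⟨K, hK⟩ => ?_⟩
  have hJ := J.2
  rw [hK] at hJ
  exact ⟨⟨K, (mul_mem_coprimeIdeals_iff.1 hJ).2⟩, Subtype.ext hK⟩

/-- A prime power divides `q * J` iff it divides `J` or is the next power of `q`. -/
theorem pow_dvd_prime_mul_iff {q p J : Ideal (𝓞 F)} (hq : Prime q) (hp : Prime p) (hJ : J ≠ ⊥)
    (k : ℕ) : p ^ (k + 1) ∣ q * J ↔
      p ^ (k + 1) ∣ J ∨ (p = q ∧ k = multiplicity q J) := by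
  have hfin := FiniteMultiplicity.of_prime_left hq hJ
  by_cases h : p = q
  · subst h
    rw [pow_succ', mul_dvd_mul_iff_left hp.ne_zero, ← pow_succ', hfin.pow_dvd_iff_le_multiplicity,
      hfin.pow_dvd_iff_le_multiplicity]
    grind
  · simp only [h, false_and, or_false]
    have hcop : IsCoprime (p ^ (k + 1)) q := by
      refine IsCoprime.pow_left ?_
      rw [Ideal.isCoprime_iff_sup_eq]
      exact Ideal.IsMaximal.coprime_of_ne ((Ideal.isPrime_of_prime hp).isMaximal hp.ne_zero)
        ((Ideal.isPrime_of_prime hq).isMaximal hq.ne_zero) h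
    exact ⟨hcop.dvd_of_dvd_mul_left, fun h => h.mul_left _⟩

theorem hasSum_log_absNorm {I : Ideal (𝓞 F)} (hI : I ∈ coprimeIdeals 𝔣) :
    HasSum (fun x : CoprimePrime 𝔣 × ℕ =>
      Set.indicator {x : CoprimePrime 𝔣 × ℕ | (x.1 : Ideal (𝓞 F)) ^ (x.2 + 1) ∣ I}
        (fun x => Real.log (Ideal.absNorm (x.1 : Ideal (𝓞 F)))) x)
      (Real.log (Ideal.absNorm I)) := by
  induction I using induction_on_prime with
  | h₁ => exact absurd rfl hI.1
  | h₂ I hu =>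
    obtain rfl := Ideal.isUnit_iff.1 hu
    rw [Ideal.absNorm_top, Nat.cast_one, Real.log_one]
    convert! hasSum_zero with x
    refine Set.indicator_of_notMem (fun hx => x.1.2.1.not_isUnit ?_) _
    exact isUnit_of_dvd_unit ((dvd_pow_self _ x.2.succ_ne_zero).trans hx) hu
  | h₃ J q hJ hq ih =>
    obtain ⟨hq𝔣, hJ𝔣⟩ := mul_mem_coprimeIdeals_iff.1 hI
    have hN {K : Ideal (𝓞 F)} (hK : K ≠ 0) : (Ideal.absNorm K : ℝ) ≠ 0 :=
      Nat.cast_ne_zero.2 (Ideal.absNorm_eq_zero_iff.not.2 hK)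
    rw [map_mul, Nat.cast_mul, Real.log_mul (hN hq.ne_zero) (hN hJ), add_comm]
    let q' : CoprimePrime 𝔣 := ⟨q, hq, hq𝔣.2⟩
    convert! (ih hJ𝔣).add (hasSum_ite_eq (q', multiplicity q J) (Real.log (Ideal.absNorm q)))
      using 1
    funext x
    obtain ⟨p, k⟩ := x
    have hiff := pow_dvd_prime_mul_iff hq p.2.1 hJ k
    have heq : (p, k) = (q', multiplicity q J) ↔ (p : Ideal (𝓞 F)) = q ∧ k = multiplicity q J := by
      rw [Prod.ext_iff, Subtype.ext_iff]
    have hdisj : (p : Ideal (𝓞 F)) = q ∧ k = multiplicity q J →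
        ¬ (p : Ideal (𝓞 F)) ^ (k + 1) ∣ J := fun ⟨hp, hk⟩ hd => by
      rw [hp, (FiniteMultiplicity.of_prime_left hq hJ).pow_dvd_iff_le_multiplicity] at hd
      omega
    simp only [Set.indicator_apply, Set.mem_ofPred_eq, hiff, heq]
    by_cases h : (p : Ideal (𝓞 F)) = q ∧ k = multiplicity q J
    · rw [if_pos (Or.inr h), if_neg (hdisj h), if_pos h, zero_add, h.1]
    · simp only [h, or_false, if_false, add_zero]

theorem isPrime_toCoprimeIdeals (p : CoprimePrime 𝔣) :
    (p : Ideal (𝓞 F)).IsPrime ∧ (p : Ideal (𝓞 F)) ≠ ⊥ :=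
  ⟨Ideal.isPrime_of_prime p.2.1, p.2.1.ne_zero⟩

/-- The ideals coprime to `𝔣` with their norms and narrow ray classes. -/
noncomputable def coprimeIdealsNormedMonoid (h𝔣 : 𝔣 ≠ ⊥) :
    letI := rayClassCommGroup h𝔣
    NormedMonoid (coprimeIdeals 𝔣) (CoprimePrime 𝔣) (RayClass 𝔣) :=
  letI := rayClassCommGroup h𝔣
  { norm := (Ideal.absNorm : Ideal (𝓞 F) →*₀ ℕ).toMonoidHom.comp (coprimeIdeals 𝔣).subtype
    cls := (rayCon 𝔣).mk'
    prime := toCoprimeIdeals 𝔣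
    mul_right_injective := fun a b c h =>
      Subtype.ext (mul_left_cancel₀ a.2.1 (congrArg Subtype.val h))
    norm_pos := fun I => Nat.pos_of_ne_zero (Ideal.absNorm_eq_zero_iff.not.2 I.2.1)
    eq_one_of_norm := fun I h => Subtype.ext ((Ideal.absNorm_eq_one_iff.1 h).trans Ideal.one_eq_top.symm)
    two_le_norm_prime := fun p => by
      have h0 : Ideal.absNorm (p : Ideal (𝓞 F)) ≠ 0 :=
        Ideal.absNorm_eq_zero_iff.not.2 p.2.1.ne_zero
      have h1 : Ideal.absNorm (p : Ideal (𝓞 F)) ≠ 1 :=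
        Ideal.absNorm_eq_one_iff.not.2 (isPrime_toCoprimeIdeals p).1.ne_top
      change 2 ≤ Ideal.absNorm (p : Ideal (𝓞 F))
      omega
    summable_norm := fun σ hσ =>
      (summable_absNorm_rpow_neg F hσ).comp_injective Subtype.val_injective
    hasSum_log := fun I => by
      simp only [coprimeIdeals_dvd_iff]
      exact hasSum_log_absNorm I.2
    smooth_count := fun W a b x₀ ha hW hWs hW0 hx₀ => exists_hasSum_class_le h𝔣 ha hW hWs hW0 hx₀ }

theorem infinite_coprimePrime_class_eq (h𝔣 : 𝔣 ≠ ⊥) (g : RayClass 𝔣) :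
    {p : CoprimePrime 𝔣 | (toCoprimeIdeals 𝔣 p : RayClass 𝔣) = g}.Infinite := by
  let := rayClassCommGroup h𝔣
  have := finite_rayClass h𝔣
  exact (coprimeIdealsNormedMonoid h𝔣).infinite_prime_cls_eq g

theorem infinite_coprimePrime_sameNarrowRayClass (h𝔣 : 𝔣 ≠ ⊥) (a : coprimeIdeals 𝔣) :
    {p : CoprimePrime 𝔣 | SameNarrowRayClass F 𝔣 p a}.Infinite := by
  refine (infinite_coprimePrime_class_eq h𝔣 (a : RayClass 𝔣)).mono fun p hp => ?_
  rw [Set.mem_ofPred_eq] at hp ⊢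
  exact (rayClass_eq_iff (a := toCoprimeIdeals 𝔣 p) (b := a)).1 hp

end NarrowRay

/-- There are infinitely many prime ideals of `F` in each narrow ray class modulo `𝔣`. -/
theorem stmt11 (F : Type*) [Field F] [NumberField F]
    (𝔣 : Ideal (𝓞 F)) (h𝔣 : 𝔣 ≠ ⊥)
    (a : Ideal (𝓞 F)) (ha : a ≠ ⊥) (hcop : a ⊔ 𝔣 = ⊤) :
    {r : Ideal (𝓞 F) | r.IsPrime ∧ r ≠ ⊥ ∧ SameNarrowRayClass F 𝔣 r a}.Infinite := by
  have h := NarrowRay.infinite_coprimePrime_sameNarrowRayClass h𝔣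
    ⟨a, ha, Ideal.isCoprime_iff_sup_eq.2 hcop⟩
  refine (h.image Subtype.val_injective.injOn).mono ?_
  rintro _ ⟨p, hp, rfl⟩
  exact ⟨(NarrowRay.isPrime_toCoprimeIdeals p).1, (NarrowRay.isPrime_toCoprimeIdeals p).2, hp⟩
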